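/- arXiv:2412.19546 — 13 statements merged into one kernel-verified Lean document; each statement's English description precedes it below -/
import Mathlib

section
/- Let v be a binary capacity on a measurable space (Ω, F) and let X : Ω → ℝ be bounded and F-measurable. Then the Choquet integral of X with respect to v satisfies ∫ X dv = sup{x ∈ ℝ : v({ω : X(ω) ≥ x}) = 1} = inf{x ∈ ℝ : v({ω : X(ω) ≥ x}) = 0}; consequently ∫ X dv = Q^v_{1/2}(X) = Q̄^v_{1/2}(X), i.e., the Choquet integral with respect to a binary capacity coincides with the left and right 1/2-Choquet quantiles for that capacity. -/
open MeasureTheory Set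

/-- A capacity on a measurable space: `w ∅ = 0`, `w Ω = 1`, and `w` is monotone
on measurable sets. -/
def IsCapacity {Ω : Type*} [MeasurableSpace Ω] (w : Set Ω → ℝ) : Prop :=
  w ∅ = 0 ∧ w Set.univ = 1 ∧
    ∀ ⦃A B : Set Ω⦄, MeasurableSet A → MeasurableSet B → A ⊆ B → w A ≤ w B

/-- A binary capacity takes only the values 0 and 1 on measurable sets. -/
def IsBinaryCapacity {Ω : Type*} [MeasurableSpace Ω] (w : Set Ω → ℝ) : Prop :=
  IsCapacity w ∧ ∀ A : Set Ω, MeasurableSet A → w A = 0 ∨ w A = 1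

/-- The Choquet integral `∫ X dw = ∫_{-∞}^0 (w{X ≥ x} - 1) dx + ∫_0^∞ w{X ≥ x} dx`. -/
noncomputable def choquetIntegral {Ω : Type*} [MeasurableSpace Ω]
    (w : Set Ω → ℝ) (X : Ω → ℝ) : ℝ :=
  (∫ x in Set.Iio (0 : ℝ), (w {ω | x ≤ X ω} - 1)) + ∫ x in Set.Ioi (0 : ℝ), w {ω | x ≤ X ω}

/-- The two integrals defining the Choquet integral, evaluated for a function that steps
from `1` down to `0` at `s`. -/
theorem integral_Iio_sub_one_add_integral_Ioi_of_step {g : ℝ → ℝ} {s : ℝ}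
    (h1 : ∀ x < s, g x = 1) (h0 : ∀ x, s < x → g x = 0) :
    (∫ x in Set.Iio (0 : ℝ), (g x - 1)) + ∫ x in Set.Ioi (0 : ℝ), g x = s := by
  have hne : ∀ᵐ x : ℝ, x ≠ s := by simp [ae_iff]
  have hneg : ∫ x in Set.Iio (0 : ℝ), (g x - 1) =
      ∫ x in Set.Iio (0 : ℝ), (Set.Ioi s).indicator (fun _ => (-1 : ℝ)) x := by
    refine integral_congr_ae (ae_restrict_of_ae ?_)
    filter_upwards [hne] with x hx
    rcases lt_or_gt_of_ne hx with h | h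
    · simp [h1 x h, h.le]
    · simp [h0 x h, h]
  have hpos : ∫ x in Set.Ioi (0 : ℝ), g x =
      ∫ x in Set.Ioi (0 : ℝ), (Set.Iio s).indicator (fun _ => (1 : ℝ)) x := by
    refine integral_congr_ae (ae_restrict_of_ae ?_)
    filter_upwards [hne] with x hx
    rcases lt_or_gt_of_ne hx with h | h
    · simp [h1 x h, h]
    · simp [h0 x h, h.le]
  rw [hneg, hpos, setIntegral_indicator measurableSet_Ioi,
    setIntegral_indicator measurableSet_Iio, Set.Iio_inter_Ioi, Set.Ioi_inter_Iio,
    setIntegral_const, setIntegral_const, Real.volume_real_Ioo, Real.volume_real_Ioo]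
  rcases le_total 0 s with h | h <;> simp [h]

/-- The supremum of a nonempty set of reals is the infimum of its complement when every
element of the set lies below every element of the complement. -/
theorem csSup_eq_csInf_compl {S : Set ℝ} (hS : S.Nonempty) (hSc : Sᶜ.Nonempty)
    (hlt : ∀ x ∈ S, ∀ y ∈ Sᶜ, x ≤ y) : sSup S = sInf Sᶜ := by
  have hbdd : BddAbove S := hSc.imp fun y hy x hx => hlt x hx y hy
  have hbdd' : BddBelow Sᶜ := hS.imp fun x hx y hy => hlt x hx y hy
  refine le_antisymm (csSup_le hS fun x hx => le_csInf hSc (hlt x hx)) ?_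
  by_contra! h
  obtain ⟨z, hz1, hz2⟩ := exists_between h
  by_cases hz : z ∈ S
  · exact hz1.not_ge (le_csSup hbdd hz)
  · exact hz2.not_ge (csInf_le hbdd' hz)

/-- For a binary capacity `v` and a bounded measurable `X`, the Choquet integral of `X`
with respect to `v` equals `sup {x | v{X ≥ x} = 1}`, `inf {x | v{X ≥ x} = 0}`, and the
left and right `1/2`-Choquet quantiles of `X` for `v`. -/
theorem choquetIntegral_binary_eq_quantiles {Ω : Type*} [MeasurableSpace Ω]
    (v : Set Ω → ℝ) (hv : IsBinaryCapacity v)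
    (X : Ω → ℝ) (hX : Measurable X) (hXb : ∃ M : ℝ, ∀ ω, |X ω| ≤ M) :
    choquetIntegral v X = sSup {x : ℝ | v {ω | x ≤ X ω} = 1} ∧
    choquetIntegral v X = sInf {x : ℝ | v {ω | x ≤ X ω} = 0} ∧
    choquetIntegral v X = sInf {x : ℝ | v {ω | x ≤ X ω} ≤ 1 - (1 / 2 : ℝ)} ∧
    choquetIntegral v X = sInf {x : ℝ | v {ω | x ≤ X ω} < 1 - (1 / 2 : ℝ)} := by
  obtain ⟨⟨hempty, huniv, hmono⟩, hbin⟩ := hv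
  obtain ⟨M, hM⟩ := hXb
  have hmeas (x : ℝ) : MeasurableSet {ω | x ≤ X ω} := measurableSet_le measurable_const hX
  have hbin' (x : ℝ) : v {ω | x ≤ X ω} = 0 ∨ v {ω | x ≤ X ω} = 1 := hbin _ (hmeas x)
  have hanti {x y : ℝ} (hxy : x ≤ y) : v {ω | y ≤ X ω} ≤ v {ω | x ≤ X ω} :=
    hmono (hmeas y) (hmeas x) fun _ hω => hxy.trans hω
  set S := {x : ℝ | v {ω | x ≤ X ω} = 1} with hS
  have hzero : {x : ℝ | v {ω | x ≤ X ω} = 0} = Sᶜ := by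
    ext x
    rcases hbin' x with h | h <;> simp [hS, h]
  have hle : {x : ℝ | v {ω | x ≤ X ω} ≤ 1 - (1 / 2 : ℝ)} = Sᶜ := by
    ext x
    rcases hbin' x with h | h <;> norm_num [hS, h]
  have hlt : {x : ℝ | v {ω | x ≤ X ω} < 1 - (1 / 2 : ℝ)} = Sᶜ := by
    ext x
    rcases hbin' x with h | h <;> norm_num [hS, h]
  have hne : S.Nonempty := by
    refine ⟨-M, ?_⟩
    have : {ω | -M ≤ X ω} = Set.univ := Set.eq_univ_of_forall fun ω => (abs_le.1 (hM ω)).1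
    simp only [hS, Set.mem_ofPred_eq, this, huniv]
  have hne' : Sᶜ.Nonempty := by
    refine ⟨M + 1, ?_⟩
    have : {ω | M + 1 ≤ X ω} = ∅ := Set.eq_empty_of_forall_notMem fun ω hω => by
      have := (abs_le.1 (hM ω)).2
      have : M + 1 ≤ X ω := hω
      linarith
    simp [hS, this, hempty]
  have hsep : ∀ x ∈ S, ∀ y ∈ Sᶜ, x ≤ y := by
    intro x hx y hy
    by_contra! h
    rw [← hzero] at hy
    have hxy := hanti h.le
    rw [show v {ω | x ≤ X ω} = 1 from hx, show v {ω | y ≤ X ω} = 0 from hy] at hxy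
    norm_num at hxy
  have hsup : sSup S = sInf Sᶜ := csSup_eq_csInf_compl hne hne' hsep
  have hint : choquetIntegral v X = sSup S := by
    refine integral_Iio_sub_one_add_integral_Ioi_of_step (g := fun x => v {ω | x ≤ X ω})
      (fun x hx => ?_) (fun x hx => ?_)
    · rw [hsup] at hx
      by_contra hxS
      exact hx.not_ge (csInf_le (hne.imp fun a ha y hy => hsep a ha y hy) hxS)
    · refine (hbin' x).resolve_right fun hxS => ?_
      exact hx.not_ge (le_csSup (hne'.imp fun y hy a ha => hsep a ha y hy) hxS)
  rw [hzero, hle, hlt, ← hsup]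
  exact ⟨hint, hint, hint, hint⟩
end

section
/- Let (Ω, F) be a measurable space and let R be a real-valued functional defined on all bounded F-measurable functions X : Ω → ℝ. Suppose R satisfies ordinality: R(φ ∘ X) = φ(R(X)) for every bounded F-measurable X and every increasing continuous function φ : ℝ → ℝ. Then there exists a binary capacity v on (Ω, F) such that R(X) = I_v(X) = inf{x ∈ ℝ : v({ω : X(ω) ≥ x}) = 0} for all bounded F-measurable X, i.e., R is a Choquet quantile. -/
open MeasureTheory Set

theorem abs_indicator_one_le {Ω : Type*} (A : Set Ω) (ω : Ω) : |A.indicator (1 : Ω → ℝ) ω| ≤ 1 := by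
  by_cases h : ω ∈ A <;> simp [h]

/-- `R` commutes with increasing continuous transformations of bounded measurable functions. -/
def IsOrdinal {Ω : Type*} [MeasurableSpace Ω] (R : (Ω → ℝ) → ℝ) : Prop :=
  ∀ X : Ω → ℝ, Measurable X → (∃ M : ℝ, ∀ ω, |X ω| ≤ M) →
    ∀ φ : ℝ → ℝ, Monotone φ → Continuous φ → R (φ ∘ X) = φ (R X)

namespace IsOrdinal

variable {Ω : Type*} [MeasurableSpace Ω] {R : (Ω → ℝ) → ℝ}

theorem map_const (hR : IsOrdinal R) (c : ℝ) : R (fun _ => c) = c :=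
  hR (fun _ => 0) measurable_const ⟨0, fun _ => by simp⟩ (fun _ => c)
    monotone_const continuous_const

theorem map_eq (hR : IsOrdinal R) {X Y : Ω → ℝ} (hY : Measurable Y)
    (hb : ∃ M : ℝ, ∀ ω, |Y ω| ≤ M) {φ : ℝ → ℝ} (hφ : Monotone φ) (hc : Continuous φ)
    (h : ∀ ω, X ω = φ (Y ω)) : R X = φ (R Y) := by
  rw [← hR Y hY hb φ hφ hc]
  exact congrArg R (funext h)

theorem map_indicator_eq_zero_or_one (hR : IsOrdinal R) {A : Set Ω} (hA : MeasurableSet A) :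
    R (A.indicator 1) = 0 ∨ R (A.indicator 1) = 1 := by
  have hmono : Monotone fun x : ℝ => (max 0 (min x 1)) ^ 2 := fun x y hxy => by
    dsimp only
    gcongr
  have key : R (A.indicator 1) = (max 0 (min (R (A.indicator 1)) 1)) ^ 2 :=
    hR.map_eq (measurable_one.indicator hA) ⟨1, abs_indicator_one_le A⟩ hmono (by fun_prop)
      fun ω => by by_cases h : ω ∈ A <;> simp [h]
  generalize R (A.indicator 1) = r at key ⊢
  rcases le_total r 0 with h0 | h0
  · rw [max_eq_left ((min_le_left _ _).trans h0)] at key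
    exact Or.inl (by simpa using key)
  · rcases le_total r 1 with h1 | h1
    · rw [min_eq_left h1, max_eq_right h0] at key
      have : r * (r - 1) = 0 := by linarith
      rcases mul_eq_zero.mp this with h | h
      · exact Or.inl h
      · exact Or.inr (sub_eq_zero.mp h)
    · rw [min_eq_right h1] at key
      exact Or.inr (by simpa using key)

theorem map_indicator_mono (hR : IsOrdinal R) {A B : Set Ω} (hA : MeasurableSet A)
    (hB : MeasurableSet B) (hAB : A ⊆ B) : R (A.indicator 1) ≤ R (B.indicator 1) := by
  have hm : Measurable (A.indicator (1 : Ω → ℝ) + B.indicator 1) :=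
    (measurable_one.indicator hA).add (measurable_one.indicator hB)
  have hb : ∃ M : ℝ, ∀ ω, |(A.indicator 1 + B.indicator 1 : Ω → ℝ) ω| ≤ M :=
    ⟨1 + 1, fun ω => (abs_add_le _ _).trans
      (add_le_add (abs_indicator_one_le A ω) (abs_indicator_one_le B ω))⟩
  have h1 : R (A.indicator 1) = max 0 (R (A.indicator 1 + B.indicator 1) - 1) :=
    hR.map_eq (φ := fun x => max 0 (x - 1)) hm hb
      (fun x y hxy => by dsimp only; gcongr) (by fun_prop) fun ω => by
      by_cases hω : ω ∈ A
      · simp [hω, hAB hω]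
      · by_cases hω' : ω ∈ B <;> simp [hω, hω']
  have h2 : R (B.indicator 1) = min 1 (R (A.indicator 1 + B.indicator 1)) :=
    hR.map_eq (φ := fun x => min 1 x) hm hb
      (fun x y hxy => by dsimp only; gcongr) (by fun_prop) fun ω => by
      by_cases hω : ω ∈ A
      · simp [hω, hAB hω]
      · by_cases hω' : ω ∈ B <;> simp [hω, hω']
  have h3 := hR.map_indicator_eq_zero_or_one hA
  have h4 := hR.map_indicator_eq_zero_or_one hB
  grind

/-- Both `X` and the indicator of `{x ≤ X}` are increasing continuous functions of
`X + 1_{x ≤ X}`; this locates `R` of the indicator. -/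
theorem map_indicator_superlevel (hR : IsOrdinal R) {X : Ω → ℝ} (hX : Measurable X)
    (hb : ∃ M : ℝ, ∀ ω, |X ω| ≤ M) (x : ℝ) :
    (R X < x → R ({ω | x ≤ X ω}.indicator 1) = 0) ∧
      (x < R X → R ({ω | x ≤ X ω}.indicator 1) = 1) := by
  set A : Set Ω := {ω | x ≤ X ω}
  have hA : MeasurableSet A := measurableSet_le measurable_const hX
  have hm : Measurable (X + A.indicator 1) := hX.add (measurable_one.indicator hA)
  have hbd : ∃ M : ℝ, ∀ ω, |(X + A.indicator 1 : Ω → ℝ) ω| ≤ M := by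
    obtain ⟨M, hM⟩ := hb
    exact ⟨M + 1, fun ω => (abs_add_le _ _).trans
      (add_le_add (hM ω) (abs_indicator_one_le A ω))⟩
  have h1 : R X = min (R (X + A.indicator 1)) (max x (R (X + A.indicator 1) - 1)) :=
    hR.map_eq (φ := fun y => min y (max x (y - 1))) hm hbd
      (fun y z hyz => by dsimp only; gcongr) (by fun_prop) fun ω => by
      by_cases hω : x ≤ X ω
      · have : ω ∈ A := hω
        simp [this, hω]
      · have : ω ∉ A := hω
        simp [this, (not_le.mp hω).le]
  have h2 : R (A.indicator 1) = max 0 (min (R (X + A.indicator 1) - x) 1) :=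
    hR.map_eq (φ := fun y => max 0 (min (y - x) 1)) hm hbd
      (fun y z hyz => by dsimp only; gcongr) (by fun_prop) fun ω => by
      by_cases hω : x ≤ X ω
      · have : ω ∈ A := hω
        have h : (1 : ℝ) ≤ X ω + 1 - x := by linarith
        simp [this, h]
      · have : ω ∉ A := hω
        simp [this, (not_le.mp hω).le]
  grind

end IsOrdinal

/-- If a real-valued functional `R` on the bounded measurable functions satisfies
ordinality (`R (φ ∘ X) = φ (R X)` for all increasing continuous `φ : ℝ → ℝ`), then `R`
is a Choquet quantile: there is a binary capacity `v` with
`R X = inf {x | v {X ≥ x} = 0}` for all bounded measurable `X`. -/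
theorem ordinality_implies_choquetQuantile {Ω : Type*} [MeasurableSpace Ω]
    (R : (Ω → ℝ) → ℝ)
    (hord : ∀ X : Ω → ℝ, Measurable X → (∃ M : ℝ, ∀ ω, |X ω| ≤ M) →
      ∀ φ : ℝ → ℝ, Monotone φ → Continuous φ → R (φ ∘ X) = φ (R X)) :
    ∃ v : Set Ω → ℝ, IsBinaryCapacity v ∧
      ∀ X : Ω → ℝ, Measurable X → (∃ M : ℝ, ∀ ω, |X ω| ≤ M) →
        R X = sInf {x : ℝ | v {ω | x ≤ X ω} = 0} := by
  have hR : IsOrdinal R := hord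
  refine ⟨fun A => R (A.indicator 1), ⟨⟨?_, ?_, ?_⟩, ?_⟩, ?_⟩
  · simpa using hR.map_const 0
  · exact (congrArg R (indicator_univ 1)).trans (hR.map_const 1)
  · exact fun A B hA hB hAB => hR.map_indicator_mono hA hB hAB
  · exact fun A hA => hR.map_indicator_eq_zero_or_one hA
  · intro X hX hb
    refine (csInf_eq_of_forall_ge_of_forall_gt_exists_lt ⟨R X + 1, ?_⟩ ?_ ?_).symm
    · exact (hR.map_indicator_superlevel hX hb _).1 (lt_add_one _)
    · intro x hx
      by_contra! hlt
      exact zero_ne_one (hx.symm.trans ((hR.map_indicator_superlevel hX hb x).2 hlt))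
    · intro y hy
      obtain ⟨x, hx, hxy⟩ := exists_between hy
      exact ⟨x, (hR.map_indicator_superlevel hX hb x).1 hx, hxy⟩
end

section
/- Let (Ω, F) be a measurable space and v a binary capacity on (Ω, F). Then the Choquet quantile I_v satisfies ordinality: for every bounded F-measurable X : Ω → ℝ and every increasing continuous function φ : ℝ → ℝ, I_v(φ ∘ X) = φ(I_v(X)). -/
open MeasureTheory Set

/-- The Choquet quantile `I_v (X) = inf {x | v {ω | X ω ≥ x} = 0}`. -/
noncomputable def choquetQuantile {Ω : Type*} [MeasurableSpace Ω]
    (v : Set Ω → ℝ) (X : Ω → ℝ) : ℝ :=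
  sInf {x : ℝ | v {ω | x ≤ X ω} = 0}

theorem IsCapacity.eq_zero_of_subset {Ω : Type*} [MeasurableSpace Ω] {w : Set Ω → ℝ}
    (hw : IsCapacity w) {A B : Set Ω} (hA : MeasurableSet A) (hB : MeasurableSet B)
    (hAB : A ⊆ B) (h : w B = 0) : w A = 0 :=
  le_antisymm (h ▸ hw.2.2 hA hB hAB) (hw.1 ▸ hw.2.2 .empty hA (empty_subset A))

theorem IsCapacity.apply_ne_zero_of_lt_choquetQuantile {Ω : Type*} [MeasurableSpace Ω]
    {w : Set Ω → ℝ} (hw : IsCapacity w) {X : Ω → ℝ} (hXb : ∃ M : ℝ, ∀ ω, |X ω| ≤ M)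
    {x : ℝ} (hx : x < choquetQuantile w X) : w {ω | x ≤ X ω} ≠ 0 := by
  obtain ⟨M, hM⟩ := hXb
  refine notMem_of_lt_csInf (s := {y : ℝ | w {ω | y ≤ X ω} = 0}) hx ⟨-M, fun y hy => ?_⟩
  by_contra! hlt
  have huniv : {ω | y ≤ X ω} = univ :=
    eq_univ_of_forall fun ω => hlt.le.trans (neg_le_of_abs_le (hM ω))
  rw [mem_ofPred_eq, huniv, hw.2.1] at hy
  exact one_ne_zero hy

theorem IsCapacity.apply_eq_zero_of_choquetQuantile_lt {Ω : Type*} [MeasurableSpace Ω]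
    {w : Set Ω → ℝ} (hw : IsCapacity w) {X : Ω → ℝ} (hX : Measurable X)
    (hXb : ∃ M : ℝ, ∀ ω, |X ω| ≤ M) {x : ℝ} (hx : choquetQuantile w X < x) :
    w {ω | x ≤ X ω} = 0 := by
  obtain ⟨M, hM⟩ := hXb
  have hne : {y : ℝ | w {ω | y ≤ X ω} = 0}.Nonempty := by
    refine ⟨M + 1, ?_⟩
    have hempty : {ω | M + 1 ≤ X ω} = ∅ :=
      eq_empty_of_forall_notMem fun ω (hω : M + 1 ≤ X ω) => by
        linarith [le_of_abs_le (hM ω)]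
    change w {ω | M + 1 ≤ X ω} = 0
    rw [hempty, hw.1]
  obtain ⟨y, hy, hyx⟩ := exists_lt_of_csInf_lt hne hx
  exact hw.eq_zero_of_subset (measurableSet_le measurable_const hX)
    (measurableSet_le measurable_const hX) (fun _ hω => hyx.le.trans hω) hy

theorem choquetQuantile_eq_of_forall {Ω : Type*} [MeasurableSpace Ω]
    {w : Set Ω → ℝ} {X : Ω → ℝ} {q : ℝ} (hlt : ∀ x < q, w {ω | x ≤ X ω} ≠ 0)
    (hgt : ∀ x > q, w {ω | x ≤ X ω} = 0) : choquetQuantile w X = q := by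
  refine csInf_eq_of_forall_ge_of_forall_gt_exists_lt ⟨q + 1, hgt _ (lt_add_one q)⟩
    (fun x hx => not_lt.1 fun hxq => hlt x hxq hx) fun y hy => ?_
  obtain ⟨x, hqx, hxy⟩ := exists_between hy
  exact ⟨x, hgt x hqx, hxy⟩

/-- A Choquet quantile `I_v` for a binary capacity `v` satisfies ordinality: for every
bounded measurable `X` and every increasing continuous `φ : ℝ → ℝ`,
`I_v (φ ∘ X) = φ (I_v X)`. -/
theorem choquetQuantile_ordinality {Ω : Type*} [MeasurableSpace Ω]
    (v : Set Ω → ℝ) (hv : IsBinaryCapacity v)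
    (X : Ω → ℝ) (hX : Measurable X) (hXb : ∃ M : ℝ, ∀ ω, |X ω| ≤ M)
    (φ : ℝ → ℝ) (hφmono : Monotone φ) (hφcont : Continuous φ) :
    choquetQuantile v (φ ∘ X) = φ (choquetQuantile v X) := by
  have hφX : Measurable (φ ∘ X) := hφcont.measurable.comp hX
  refine choquetQuantile_eq_of_forall (fun y hy h0 => ?_) fun y hy => ?_
  · obtain ⟨x, hxq, hyx⟩ :=
      ((hφcont.tendsto (choquetQuantile v X)).eventually_const_lt hy).exists_lt
    exact hv.1.apply_ne_zero_of_lt_choquetQuantile hXb hxq <|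
      hv.1.eq_zero_of_subset (measurableSet_le measurable_const hX)
        (measurableSet_le measurable_const hφX) (fun _ hω => hyx.le.trans (hφmono hω)) h0
  · obtain ⟨x, hqx, hxy⟩ :=
      ((hφcont.tendsto (choquetQuantile v X)).eventually_lt_const hy).exists_gt
    exact hv.1.eq_zero_of_subset (measurableSet_le measurable_const hφX)
      (measurableSet_le measurable_const hX)
      (fun _ hω => (hφmono.reflect_lt (hxy.trans_le hω)).le)
      (hv.1.apply_eq_zero_of_choquetQuantile_lt hX hXb hqx)
end

section
/- Let (Ω, F) be a measurable space and let R₀ be a real-valued functional on the bounded F-measurable functions X : Ω → ℝ (a numerical representation of a preference) satisfying R₀(0) < R₀(1) (where 0 and 1 denote constant functions). Then the following are equivalent: (i) for all bounded F-measurable X, Y and every increasing continuous φ : ℝ → ℝ, R₀(X) ≤ R₀(Y) implies R₀(φ ∘ X) ≤ R₀(φ ∘ Y); (ii) there exists a real-valued functional R on the bounded F-measurable functions such that R(X) ≤ R(Y) if and only if R₀(X) ≤ R₀(Y) for all bounded F-measurable X, Y, and R(φ ∘ X) = φ(R(X)) for every bounded F-measurable X and every increasing continuous φ : ℝ → ℝ.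 -/
open MeasureTheory Set

/-- Bounded measurable real-valued function. -/
def IsBoundedMeasurable {Ω : Type*} [MeasurableSpace Ω] (X : Ω → ℝ) : Prop :=
  Measurable X ∧ ∃ M : ℝ, ∀ ω, |X ω| ≤ M

theorem IsBoundedMeasurable.const {Ω : Type*} [MeasurableSpace Ω] (x : ℝ) :
    IsBoundedMeasurable (fun _ : Ω => x) :=
  ⟨measurable_const, |x|, fun _ => le_rfl⟩

theorem IsBoundedMeasurable.comp_monotone {Ω : Type*} [MeasurableSpace Ω] {X : Ω → ℝ}
    (hX : IsBoundedMeasurable X) {φ : ℝ → ℝ} (hφ : Monotone φ) (hc : Continuous φ) :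
    IsBoundedMeasurable (φ ∘ X) := by
  obtain ⟨hm, M, hM⟩ := hX
  refine ⟨hc.measurable.comp hm, max |φ (-M)| |φ M|, fun ω => ?_⟩
  obtain ⟨h₁, h₂⟩ := abs_le.mp (hM ω)
  exact abs_le_max_abs_abs (hφ h₁) (hφ h₂)

/-- The preference represented by `R₀` is preserved by increasing continuous transformations. -/
def PreservesPreference {Ω : Type*} [MeasurableSpace Ω] (R₀ : (Ω → ℝ) → ℝ) : Prop :=
  ∀ X Y : Ω → ℝ, IsBoundedMeasurable X → IsBoundedMeasurable Y →
    ∀ φ : ℝ → ℝ, Monotone φ → Continuous φ → R₀ X ≤ R₀ Y → R₀ (φ ∘ X) ≤ R₀ (φ ∘ Y)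

namespace PreservesPreference

variable {Ω : Type*} [MeasurableSpace Ω] {R₀ : (Ω → ℝ) → ℝ}

theorem comp_eq (h : PreservesPreference R₀) {X Y : Ω → ℝ} (hX : IsBoundedMeasurable X)
    (hY : IsBoundedMeasurable Y) {φ : ℝ → ℝ} (hφ : Monotone φ) (hc : Continuous φ)
    (hXY : R₀ X = R₀ Y) : R₀ (φ ∘ X) = R₀ (φ ∘ Y) :=
  le_antisymm (h X Y hX hY φ hφ hc hXY.le) (h Y X hY hX φ hφ hc hXY.ge)

theorem strictMono_const (h : PreservesPreference R₀)
    (h01 : R₀ (fun _ => (0 : ℝ)) < R₀ (fun _ => (1 : ℝ))) :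
    StrictMono (fun x : ℝ => R₀ (fun _ => x)) := by
  intro x y hxy
  by_contra! hle
  have hpos : 0 < y - x := sub_pos.mpr hxy
  have key := h _ _ (.const y) (.const x) (fun u => (u - x) / (y - x))
    (fun a b hab => by dsimp only; gcongr) (by fun_prop) hle
  simp only [Function.comp_def, sub_self, zero_div, div_self hpos.ne'] at key
  exact key.not_gt h01

/-- Every bounded measurable function has a certainty equivalent. -/
theorem exists_const_eq (h : PreservesPreference R₀)
    (h01 : R₀ (fun _ => (0 : ℝ)) < R₀ (fun _ => (1 : ℝ)))
    {X : Ω → ℝ} (hX : IsBoundedMeasurable X) : ∃ x : ℝ, R₀ (fun _ => x) = R₀ X := by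
  have hmono := h.strictMono_const h01
  obtain ⟨M, hM⟩ := hX.2
  let S : Set ℝ := {x | R₀ (fun _ => x) ≤ R₀ X}
  have hne : S.Nonempty := by
    refine ⟨-M - 1, ?_⟩
    by_contra hlt
    have key := h _ _ hX (.const (-M - 1)) (fun u => min u (-M))
      (fun a b hab => min_le_min_right _ hab) (by fun_prop) (not_le.mp hlt).le
    have hconst : (fun u => min u (-M)) ∘ X = fun _ => -M :=
      funext fun ω => min_eq_right (abs_le.mp (hM ω)).1
    rw [hconst, Function.comp_def, min_eq_left (by linarith)] at key
    linarith [hmono.le_iff_le.mp key]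
  have hbdd : BddAbove S := by
    refine ⟨M, fun x hx => ?_⟩
    by_contra! hlt
    have key := h _ _ (.const x) hX (fun u => max u M)
      (fun a b hab => max_le_max_right _ hab) (by fun_prop) hx
    have hconst : (fun u => max u M) ∘ X = fun _ => M :=
      funext fun ω => max_eq_right (abs_le.mp (hM ω)).2
    rw [hconst, Function.comp_def, max_eq_left hlt.le] at key
    exact hlt.not_ge (hmono.le_iff_le.mp key)
  have shift_mono (t : ℝ) : Monotone (fun u : ℝ => u + t) := fun a b hab => by
    dsimp only; gcongr
  have shift_cont (t : ℝ) : Continuous (fun u : ℝ => u + t) := by fun_prop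
  -- It suffices to compare translates at a continuity point of `R₀` on constants.
  obtain ⟨p, hp⟩ := (hmono.monotone.countable_not_continuousAt.dense_compl ℝ).nonempty
  have hp : ContinuousAt (fun x : ℝ => R₀ (fun _ => x)) p := not_not.mp hp
  set s := sSup S
  have hY := hX.comp_monotone (shift_mono (p - s)) (shift_cont (p - s))
  have heq : R₀ (fun _ => p) = R₀ ((fun u => u + (p - s)) ∘ X) := by
    apply le_antisymm
    · refine le_of_tendsto (hp.tendsto.mono_left (nhdsWithin_le_nhds (s := Iio p))) ?_
      filter_upwards [self_mem_nhdsWithin] with y hy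
      obtain ⟨x, hx, hlt⟩ := exists_lt_of_lt_csSup hne
        (show y - (p - s) < s by linarith [mem_Iio.mp hy])
      have key := h _ _ (.const (y - (p - s))) hX _ (shift_mono (p - s)) (shift_cont (p - s))
        ((hmono.monotone hlt.le).trans hx)
      simpa only [Function.comp_def, sub_add_cancel] using key
    · refine ge_of_tendsto (hp.tendsto.mono_left (nhdsWithin_le_nhds (s := Ioi p))) ?_
      filter_upwards [self_mem_nhdsWithin] with y hy
      have hnot : y - (p - s) ∉ S :=
        notMem_of_csSup_lt (show s < y - (p - s) by linarith [mem_Ioi.mp hy]) hbdd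
      have key := h _ _ hX (.const (y - (p - s))) _ (shift_mono (p - s)) (shift_cont (p - s))
        (not_le.mp hnot).le
      simpa only [Function.comp_def, sub_add_cancel] using key
  refine ⟨p + (s - p), ?_⟩
  have key := h.comp_eq (.const p) hY (shift_mono (s - p)) (shift_cont (s - p)) heq
  have hback : (fun u => u + (s - p)) ∘ (fun u => u + (p - s)) ∘ X = X :=
    funext fun ω => by simp only [Function.comp_apply]; ring
  rwa [hback] at key

end PreservesPreference

/-- Let `R₀` numerically represent a preference on the bounded measurable functions, with
`R₀ 0 < R₀ 1` (the preference is increasing).  Then the preference is preserved by every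
increasing continuous transformation `φ` (i.e. `R₀ X ≤ R₀ Y` implies
`R₀ (φ ∘ X) ≤ R₀ (φ ∘ Y)`) if and only if there is a numerical representation `R` of the
same preference satisfying ordinality (`R (φ ∘ X) = φ (R X)`). -/
theorem preference_ordinality_iff_ordinal_representation
    {Ω : Type*} [MeasurableSpace Ω] (R₀ : (Ω → ℝ) → ℝ)
    (h01 : R₀ (fun _ => (0 : ℝ)) < R₀ (fun _ => (1 : ℝ))) :
    (∀ X Y : Ω → ℝ, IsBoundedMeasurable X → IsBoundedMeasurable Y →
      ∀ φ : ℝ → ℝ, Monotone φ → Continuous φ →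
        R₀ X ≤ R₀ Y → R₀ (φ ∘ X) ≤ R₀ (φ ∘ Y)) ↔
    (∃ R : (Ω → ℝ) → ℝ,
      (∀ X Y : Ω → ℝ, IsBoundedMeasurable X → IsBoundedMeasurable Y →
        (R X ≤ R Y ↔ R₀ X ≤ R₀ Y)) ∧
      (∀ X : Ω → ℝ, IsBoundedMeasurable X →
        ∀ φ : ℝ → ℝ, Monotone φ → Continuous φ → R (φ ∘ X) = φ (R X))) := by
  constructor
  · intro h
    have h : PreservesPreference R₀ := h
    have hmono := h.strictMono_const h01
    have hex (X : Ω → ℝ) : ∃ x : ℝ, IsBoundedMeasurable X → R₀ (fun _ => x) = R₀ X := by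
      by_cases hX : IsBoundedMeasurable X
      · obtain ⟨x, hx⟩ := h.exists_const_eq h01 hX
        exact ⟨x, fun _ => hx⟩
      · exact ⟨0, fun hX' => absurd hX' hX⟩
    choose R hR using hex
    refine ⟨R, fun X Y hX hY => ?_, fun X hX φ hφ hc => ?_⟩
    · rw [← hR X hX, ← hR Y hY]
      exact hmono.le_iff_le.symm
    · exact hmono.injective ((hR _ (hX.comp_monotone hφ hc)).trans
        (h.comp_eq (.const (R X)) hX hφ hc (hR X hX)).symm)
  · rintro ⟨R, hrep, hord⟩ X Y hX hY φ hφ hc hXY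
    rw [← hrep _ _ (hX.comp_monotone hφ hc) (hY.comp_monotone hφ hc), hord X hX φ hφ hc,
      hord Y hY φ hφ hc]
    exact hφ ((hrep X Y hX hY).mpr hXY)
end

section
/- Let (Ω, F) be a measurable space, let W be a nonempty set of capacities on (Ω, F), let V be a nonempty set of binary capacities on (Ω, F), let α ∈ (0,1), and let X : Ω → ℝ be bounded and F-measurable. Define w̄(A) = sup_{w ∈ W} w(A) and v̄(A) = sup_{v ∈ V} v(A) for A ∈ F. Then w̄ is a capacity, v̄ is a binary capacity, sup_{w ∈ W} Q^w_α(X) = Q^{w̄}_α(X), and sup_{v ∈ V} I_v(X) = I_{v̄}(X). -/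
open MeasureTheory Set

/-- The left `α`-Choquet quantile `Q^w_α (X) = inf {x | w {X ≥ x} ≤ 1 - α}`. -/
noncomputable def leftQuantile {Ω : Type*} [MeasurableSpace Ω]
    (w : Set Ω → ℝ) (α : ℝ) (X : Ω → ℝ) : ℝ :=
  sInf {x : ℝ | w {ω | x ≤ X ω} ≤ 1 - α}

/-- The infimum of an intersection of upper sets of reals is the supremum of their infima. -/
theorem sSup_image_sInf_eq_sInf_of_isUpperSet {ι : Type*} {s : Set ι} (hs : s.Nonempty)
    {S : ι → Set ℝ} {T : Set ℝ} (hT : ∀ x, x ∈ T ↔ ∀ i ∈ s, x ∈ S i)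
    (hup : ∀ i ∈ s, IsUpperSet (S i)) (hne : T.Nonempty) {m : ℝ}
    (hm : ∀ i ∈ s, m ∈ lowerBounds (S i)) :
    sSup ((fun i => sInf (S i)) '' s) = sInf T := by
  have hle : ∀ i ∈ s, sInf (S i) ≤ sInf T := fun i hi =>
    csInf_le_csInf ⟨m, hm i hi⟩ hne fun x hx => (hT x).1 hx i hi
  have hTbdd : BddBelow T := by
    obtain ⟨i, hi⟩ := hs
    exact ⟨m, fun x hx => hm i hi ((hT x).1 hx i hi)⟩
  apply le_antisymm
  · apply csSup_le (hs.image _)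
    rintro _ ⟨i, hi, rfl⟩
    exact hle i hi
  · refine le_of_forall_gt_imp_ge_of_dense fun y hy => csInf_le hTbdd ((hT y).2 fun i hi => ?_)
    have hbdd : BddAbove ((fun i => sInf (S i)) '' s) := by
      refine ⟨sInf T, ?_⟩
      rintro _ ⟨j, hj, rfl⟩
      exact hle j hj
    have hlt : sInf (S i) < y := (le_csSup hbdd (mem_image_of_mem _ hi)).trans_lt hy
    obtain ⟨z, hz, hzy⟩ :=
      exists_lt_of_csInf_lt (hne.mono fun x hx => (hT x).1 hx i hi) hlt
    exact hup i hi hzy.le hz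

section Capacity

variable {Ω : Type*} [MeasurableSpace Ω]

theorem IsCapacity.le_one {w : Set Ω → ℝ} (hw : IsCapacity w) {A : Set Ω}
    (hA : MeasurableSet A) : w A ≤ 1 :=
  hw.2.1 ▸ hw.2.2 hA MeasurableSet.univ (subset_univ A)

theorem bddAbove_image_apply_of_isCapacity {W : Set (Set Ω → ℝ)} (hW : ∀ w ∈ W, IsCapacity w)
    {A : Set Ω} (hA : MeasurableSet A) : BddAbove ((fun w : Set Ω → ℝ => w A) '' W) := by
  refine ⟨1, ?_⟩
  rintro _ ⟨w, hw, rfl⟩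
  exact (hW w hw).le_one hA

theorem sSup_image_apply_le_iff {W : Set (Set Ω → ℝ)} (hne : W.Nonempty)
    (hW : ∀ w ∈ W, IsCapacity w) {A : Set Ω} (hA : MeasurableSet A) {c : ℝ} :
    sSup ((fun w : Set Ω → ℝ => w A) '' W) ≤ c ↔ ∀ w ∈ W, w A ≤ c := by
  rw [csSup_le_iff (bddAbove_image_apply_of_isCapacity hW hA) (hne.image _), forall_mem_image]

theorem isCapacity_sSup {W : Set (Set Ω → ℝ)} (hne : W.Nonempty)
    (hW : ∀ w ∈ W, IsCapacity w) :
    IsCapacity (fun A : Set Ω => sSup ((fun w : Set Ω → ℝ => w A) '' W)) := by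
  refine ⟨?_, ?_, fun A B hA hB hAB => ?_⟩
  · have h : (fun w : Set Ω → ℝ => w ∅) '' W = {0} := by
      rw [image_congr fun w hw => (hW w hw).1, hne.image_const]
    simp only [h, csSup_singleton]
  · have h : (fun w : Set Ω → ℝ => w univ) '' W = {1} := by
      rw [image_congr fun w hw => (hW w hw).2.1, hne.image_const]
    simp only [h, csSup_singleton]
  · exact (sSup_image_apply_le_iff hne hW hA).2 fun w hw => ((hW w hw).2.2 hA hB hAB).trans
      (le_csSup (bddAbove_image_apply_of_isCapacity hW hB) (mem_image_of_mem _ hw))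

theorem isBinaryCapacity_sSup {V : Set (Set Ω → ℝ)} (hne : V.Nonempty)
    (hV : ∀ v ∈ V, IsBinaryCapacity v) :
    IsBinaryCapacity (fun A : Set Ω => sSup ((fun v : Set Ω → ℝ => v A) '' V)) := by
  refine ⟨isCapacity_sSup hne fun v hv => (hV v hv).1, fun A hA => ?_⟩
  have hmem : sSup ((fun v : Set Ω → ℝ => v A) '' V) ∈ (fun v : Set Ω → ℝ => v A) '' V := by
    refine (hne.image _).csSup_mem ((Set.toFinite {(0 : ℝ), 1}).subset ?_)
    rintro _ ⟨v, hv, rfl⟩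
    exact (hV v hv).2 A hA
  obtain ⟨v, hv, h⟩ := hmem
  simp only [← h]
  exact (hV v hv).2 A hA

theorem sSup_leftQuantile {W : Set (Set Ω → ℝ)} (hne : W.Nonempty)
    (hW : ∀ w ∈ W, IsCapacity w) {α : ℝ} (hα : α ∈ Ioc (0 : ℝ) 1) {X : Ω → ℝ}
    (hX : Measurable X) (hXb : ∃ M : ℝ, ∀ ω, |X ω| ≤ M) :
    sSup ((fun w : Set Ω → ℝ => leftQuantile w α X) '' W)
      = leftQuantile (fun A : Set Ω => sSup ((fun w : Set Ω → ℝ => w A) '' W)) α X := by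
  obtain ⟨M, hM⟩ := hXb
  have hmeas : ∀ x : ℝ, MeasurableSet {ω | x ≤ X ω} := fun x =>
    measurableSet_le measurable_const hX
  refine sSup_image_sInf_eq_sInf_of_isUpperSet (m := -M) hne
    (fun x => sSup_image_apply_le_iff hne hW (hmeas x)) ?_ ⟨M + 1, ?_⟩ ?_
  · intro w hw x y hxy hx
    exact ((hW w hw).2.2 (hmeas y) (hmeas x) fun ω hω => hxy.trans hω).trans hx
  · have h : {ω | M + 1 ≤ X ω} = ∅ := by
      ext ω
      simpa using ((le_abs_self _).trans (hM ω)).trans_lt (lt_add_one M)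
    rw [mem_ofPred_eq, h, (isCapacity_sSup hne hW).1]
    linarith [hα.2]
  · intro w hw x hx
    by_contra! hlt
    have h : {ω | x ≤ X ω} = univ :=
      eq_univ_of_forall fun ω => hlt.le.trans (neg_le_of_abs_le (hM ω))
    rw [mem_ofPred_eq, h, (hW w hw).2.1] at hx
    linarith [hα.1]

theorem IsBinaryCapacity.choquetQuantile_eq_leftQuantile {v : Set Ω → ℝ}
    (hv : IsBinaryCapacity v) {α : ℝ} (hα : α ∈ Ioc (0 : ℝ) 1) {X : Ω → ℝ} (hX : Measurable X) :
    choquetQuantile v X = leftQuantile v α X := by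
  have h : ∀ x : ℝ, v {ω | x ≤ X ω} = 0 ↔ v {ω | x ≤ X ω} ≤ 1 - α := by
    intro x
    obtain ⟨h0, h1⟩ := hα
    rcases hv.2 _ (measurableSet_le (measurable_const (a := x)) hX) with h | h <;> rw [h]
    · simpa using h1
    · simpa using h0
  simp only [choquetQuantile, leftQuantile, h]

end Capacity

/-- For a nonempty set `W` of capacities and a nonempty set `V` of binary capacities, the
pointwise suprema `w̄ = sup_{w ∈ W} w` and `v̄ = sup_{v ∈ V} v` are a capacity and a
binary capacity respectively, and for bounded measurable `X` and `α ∈ (0,1)`: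
`sup_{w ∈ W} Q^w_α(X) = Q^{w̄}_α(X)` and `sup_{v ∈ V} I_v(X) = I_{v̄}(X)`. -/
theorem sup_of_quantiles {Ω : Type*} [MeasurableSpace Ω]
    (W V : Set (Set Ω → ℝ)) (hW : W.Nonempty) (hV : V.Nonempty)
    (hWcap : ∀ w ∈ W, IsCapacity w) (hVcap : ∀ v ∈ V, IsBinaryCapacity v)
    (α : ℝ) (hα : α ∈ Set.Ioo (0 : ℝ) 1)
    (X : Ω → ℝ) (hX : Measurable X) (hXb : ∃ M : ℝ, ∀ ω, |X ω| ≤ M) :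
    IsCapacity (fun A : Set Ω => sSup ((fun w : Set Ω → ℝ => w A) '' W)) ∧
    IsBinaryCapacity (fun A : Set Ω => sSup ((fun v : Set Ω → ℝ => v A) '' V)) ∧
    sSup ((fun w : Set Ω → ℝ => leftQuantile w α X) '' W)
      = leftQuantile (fun A : Set Ω => sSup ((fun w : Set Ω → ℝ => w A) '' W)) α X ∧
    sSup ((fun v : Set Ω → ℝ => choquetQuantile v X) '' V)
      = choquetQuantile (fun A : Set Ω => sSup ((fun v : Set Ω → ℝ => v A) '' V)) X := by
  have hα' : α ∈ Ioc (0 : ℝ) 1 := ⟨hα.1, hα.2.le⟩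
  have hVbar := isBinaryCapacity_sSup hV hVcap
  refine ⟨isCapacity_sSup hW hWcap, hVbar, sSup_leftQuantile hW hWcap hα' hX hXb, ?_⟩
  rw [hVbar.choquetQuantile_eq_leftQuantile hα' hX,
    image_congr fun v hv => (hVcap v hv).choquetQuantile_eq_leftQuantile hα' hX]
  exact sSup_leftQuantile hV (fun v hv => (hVcap v hv).1) hα' hX hXb
end

section
/- Let (Ω, F) be a measurable space, let W be a nonempty set of capacities on (Ω, F), let V be a nonempty set of binary capacities on (Ω, F), let α ∈ (0,1), and let X : Ω → ℝ be bounded and F-measurable. Define w̲(A) = inf_{w ∈ W} w(A) and v̲(A) = inf_{v ∈ V} v(A) for A ∈ F. Then w̲ is a capacity, v̲ is a binary capacity, inf_{w ∈ W} Q̄^w_α(X) = Q̄^{w̲}_α(X), and inf_{v ∈ V} I_v(X) = I_{v̲}(X). -/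
open MeasureTheory Set

/-- The right `α`-Choquet quantile `Q̄^w_α (X) = inf {x | w {X ≥ x} < 1 - α}`. -/
noncomputable def rightQuantile {Ω : Type*} [MeasurableSpace Ω]
    (w : Set Ω → ℝ) (α : ℝ) (X : Ω → ℝ) : ℝ :=
  sInf {x : ℝ | w {ω | x ≤ X ω} < 1 - α}

theorem sInf_image_sInf_eq_sInf_biUnion {ι : Type*} {T : Set ι} {S : ι → Set ℝ} {m : ℝ}
    (hT : T.Nonempty) (hne : ∀ i ∈ T, (S i).Nonempty) (hm : ∀ i ∈ T, m ∈ lowerBounds (S i)) :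
    sInf ((fun i => sInf (S i)) '' T) = sInf (⋃ i ∈ T, S i) := by
  have hbdd : BddBelow (⋃ i ∈ T, S i) := by
    refine ⟨m, fun x hx => ?_⟩
    obtain ⟨i, hi, hxi⟩ := mem_iUnion₂.1 hx
    exact hm i hi hxi
  have hbdd' : BddBelow ((fun i => sInf (S i)) '' T) :=
    ⟨m, forall_mem_image.2 fun i hi => le_csInf (hne i hi) (hm i hi)⟩
  apply le_antisymm
  · obtain ⟨i, hi⟩ := hT
    obtain ⟨x, hx⟩ := hne i hi
    refine le_csInf ⟨x, mem_biUnion hi hx⟩ fun y hy => ?_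
    obtain ⟨j, hj, hyj⟩ := mem_iUnion₂.1 hy
    exact (csInf_le hbdd' (mem_image_of_mem _ hj)).trans (csInf_le ⟨m, hm j hj⟩ hyj)
  · exact le_csInf (hT.image _) <| forall_mem_image.2 fun i hi =>
      csInf_le_csInf hbdd (hne i hi) (subset_biUnion_of_mem (u := S) hi)

section Capacity

variable {Ω : Type*} [MeasurableSpace Ω]

theorem IsCapacity.nonneg {w : Set Ω → ℝ} (hw : IsCapacity w) {A : Set Ω}
    (hA : MeasurableSet A) : 0 ≤ w A :=
  hw.1 ▸ hw.2.2 MeasurableSet.empty hA (empty_subset A)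

theorem bddBelow_image_capacity {W : Set (Set Ω → ℝ)} (hW : ∀ w ∈ W, IsCapacity w)
    {A : Set Ω} (hA : MeasurableSet A) : BddBelow ((fun w : Set Ω → ℝ => w A) '' W) :=
  ⟨0, forall_mem_image.2 fun w hw => (hW w hw).nonneg hA⟩

theorem isCapacity_sInf {W : Set (Set Ω → ℝ)} (hne : W.Nonempty)
    (hW : ∀ w ∈ W, IsCapacity w) :
    IsCapacity (fun A : Set Ω => sInf ((fun w : Set Ω → ℝ => w A) '' W)) := by
  refine ⟨?_, ?_, fun A B hA hB hAB => ?_⟩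
  · have h : (fun w : Set Ω → ℝ => w ∅) '' W = (fun _ => 0) '' W :=
      image_congr fun w hw => (hW w hw).1
    simp only [h, hne.image_const, csInf_singleton]
  · have h : (fun w : Set Ω → ℝ => w univ) '' W = (fun _ => 1) '' W :=
      image_congr fun w hw => (hW w hw).2.1
    simp only [h, hne.image_const, csInf_singleton]
  · exact le_csInf (hne.image _) <| forall_mem_image.2 fun w hw =>
      (csInf_le (bddBelow_image_capacity hW hA) (mem_image_of_mem _ hw)).trans
        ((hW w hw).2.2 hA hB hAB)

theorem isBinaryCapacity_sInf {V : Set (Set Ω → ℝ)} (hne : V.Nonempty)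
    (hV : ∀ v ∈ V, IsBinaryCapacity v) :
    IsBinaryCapacity (fun A : Set Ω => sInf ((fun v : Set Ω → ℝ => v A) '' V)) := by
  have hcap : ∀ v ∈ V, IsCapacity v := fun v hv => (hV v hv).1
  refine ⟨isCapacity_sInf hne hcap, fun A hA => ?_⟩
  by_cases h : ∃ v ∈ V, v A = 0
  · obtain ⟨v, hv, hvA⟩ := h
    refine Or.inl (le_antisymm ?_ ((isCapacity_sInf hne hcap).nonneg hA))
    exact (csInf_le (bddBelow_image_capacity hcap hA) (mem_image_of_mem _ hv)).trans_eq hvA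
  · push Not at h
    have hone : (fun v : Set Ω → ℝ => v A) '' V = (fun _ => 1) '' V :=
      image_congr fun v hv => ((hV v hv).2 A hA).resolve_left (h v hv)
    right
    simp only [hone, hne.image_const, csInf_singleton]

theorem sInf_rightQuantile {W : Set (Set Ω → ℝ)} (hne : W.Nonempty)
    (hW : ∀ w ∈ W, IsCapacity w) {α : ℝ} (hα : α ∈ Ico (0 : ℝ) 1)
    {X : Ω → ℝ} (hX : Measurable X) (hXb : ∃ M : ℝ, ∀ ω, |X ω| ≤ M) :
    sInf ((fun w : Set Ω → ℝ => rightQuantile w α X) '' W)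
      = rightQuantile (fun A : Set Ω => sInf ((fun w : Set Ω → ℝ => w A) '' W)) α X := by
  obtain ⟨M, hM⟩ := hXb
  unfold rightQuantile
  rw [sInf_image_sInf_eq_sInf_biUnion (m := -M) hne]
  · congr 1
    ext x
    have hA : MeasurableSet {ω | x ≤ X ω} := measurableSet_le measurable_const hX
    rw [mem_ofPred_eq, csInf_lt_iff (bddBelow_image_capacity hW hA) (hne.image _)]
    simp
  · intro w hw
    have h : {ω | M + 1 ≤ X ω} = ∅ :=
      eq_empty_of_forall_notMem fun ω hω => by
        linarith [mem_ofPred_eq ▸ hω, (abs_le.1 (hM ω)).2]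
    refine ⟨M + 1, ?_⟩
    rw [mem_ofPred_eq, h, (hW w hw).1]
    linarith [hα.2]
  · intro w hw x hx
    by_contra! hlt
    have h : {ω | x ≤ X ω} = univ :=
      eq_univ_of_forall fun ω => hlt.le.trans (abs_le.1 (hM ω)).1
    rw [mem_ofPred_eq, h, (hW w hw).2.1] at hx
    linarith [hα.1]

theorem IsBinaryCapacity.choquetQuantile_eq_rightQuantile {v : Set Ω → ℝ}
    (hv : IsBinaryCapacity v) {α : ℝ} (hα : α ∈ Ico (0 : ℝ) 1) {X : Ω → ℝ}
    (hX : Measurable X) : choquetQuantile v X = rightQuantile v α X := by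
  unfold choquetQuantile rightQuantile
  congr 1
  ext x
  simp only [mem_ofPred_eq]
  obtain ⟨h0, h1⟩ := hα
  rcases hv.2 _ (measurableSet_le measurable_const hX : MeasurableSet {ω | x ≤ X ω}) with h | h
  · simp [h, h1]
  · simp [h, h0]

end Capacity

/-- For a nonempty set `W` of capacities and a nonempty set `V` of binary capacities, the
pointwise infima `w̲ = inf_{w ∈ W} w` and `v̲ = inf_{v ∈ V} v` are a capacity and a
binary capacity respectively, and for bounded measurable `X` and `α ∈ (0,1)`:
`inf_{w ∈ W} Q̄^w_α(X) = Q̄^{w̲}_α(X)` and `inf_{v ∈ V} I_v(X) = I_{v̲}(X)`. -/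
theorem inf_of_quantiles {Ω : Type*} [MeasurableSpace Ω]
    (W V : Set (Set Ω → ℝ)) (hW : W.Nonempty) (hV : V.Nonempty)
    (hWcap : ∀ w ∈ W, IsCapacity w) (hVcap : ∀ v ∈ V, IsBinaryCapacity v)
    (α : ℝ) (hα : α ∈ Set.Ioo (0 : ℝ) 1)
    (X : Ω → ℝ) (hX : Measurable X) (hXb : ∃ M : ℝ, ∀ ω, |X ω| ≤ M) :
    IsCapacity (fun A : Set Ω => sInf ((fun w : Set Ω → ℝ => w A) '' W)) ∧
    IsBinaryCapacity (fun A : Set Ω => sInf ((fun v : Set Ω → ℝ => v A) '' V)) ∧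
    sInf ((fun w : Set Ω → ℝ => rightQuantile w α X) '' W)
      = rightQuantile (fun A : Set Ω => sInf ((fun w : Set Ω → ℝ => w A) '' W)) α X ∧
    sInf ((fun v : Set Ω → ℝ => choquetQuantile v X) '' V)
      = choquetQuantile (fun A : Set Ω => sInf ((fun v : Set Ω → ℝ => v A) '' V)) X := by
  have hα' : α ∈ Ico (0 : ℝ) 1 := Ioo_subset_Ico_self hα
  refine ⟨isCapacity_sInf hW hWcap, isBinaryCapacity_sInf hV hVcap,
    sInf_rightQuantile hW hWcap hα' hX hXb, ?_⟩
  rw [(isBinaryCapacity_sInf hV hVcap).choquetQuantile_eq_rightQuantile hα' hX,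
    ← sInf_rightQuantile hV (fun v hv => (hVcap v hv).1) hα' hX hXb,
    image_congr fun v hv => (hVcap v hv).choquetQuantile_eq_rightQuantile hα' hX]
end

section
/- Let (Ω, F) be a measurable space and v a binary capacity on (Ω, F). Then the Choquet quantile I_v is convex on the bounded F-measurable functions (that is, I_v(λX + (1−λ)Y) ≤ λ I_v(X) + (1−λ) I_v(Y) for all λ ∈ [0,1] and all bounded F-measurable X, Y) if and only if the null set C_v = {A ∈ F : v(A) = 0} is closed under union (A, B ∈ C_v implies A ∪ B ∈ C_v). -/
open MeasureTheory Set

theorem IsBinaryCapacity.null_of_subset {Ω : Type*} [MeasurableSpace Ω] {v : Set Ω → ℝ}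
    (hv : IsBinaryCapacity v) {A B : Set Ω} (hA : MeasurableSet A) (hB : MeasurableSet B)
    (hAB : A ⊆ B) (h : v B = 0) : v A = 0 := by
  have hle := hv.1.2.2 hA hB hAB
  rcases hv.2 A hA with h0 | h1
  · exact h0
  · linarith

theorem choquetQuantile_le {Ω : Type*} [MeasurableSpace Ω] {v : Set Ω → ℝ}
    (hv : IsCapacity v) {X : Ω → ℝ} {m : ℝ} (hm : ∀ ω, m ≤ X ω) {x : ℝ}
    (hx : v {ω | x ≤ X ω} = 0) : choquetQuantile v X ≤ x := by
  refine csInf_le ⟨m, fun y hy => ?_⟩ hx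
  by_contra! hlt
  have huniv : {ω | y ≤ X ω} = Set.univ :=
    Set.eq_univ_of_forall fun ω => hlt.le.trans (hm ω)
  rw [Set.mem_ofPred_eq, huniv, hv.2.1] at hy
  exact one_ne_zero hy

theorem null_of_choquetQuantile_lt {Ω : Type*} [MeasurableSpace Ω] {v : Set Ω → ℝ}
    (hv : IsBinaryCapacity v) {X : Ω → ℝ} (hX : Measurable X) {M : ℝ} (hM : ∀ ω, X ω ≤ M)
    {x : ℝ} (hx : choquetQuantile v X < x) : v {ω | x ≤ X ω} = 0 := by
  have hne : {y : ℝ | v {ω | y ≤ X ω} = 0}.Nonempty := by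
    refine ⟨M + 1, ?_⟩
    have hempty : {ω | M + 1 ≤ X ω} = ∅ :=
      Set.eq_empty_of_forall_notMem fun ω hω => by
        have := hM ω
        rw [Set.mem_ofPred_eq] at hω
        linarith
    rw [Set.mem_ofPred_eq, hempty, hv.1.1]
  obtain ⟨y, hy, hyx⟩ := exists_lt_of_csInf_lt hne hx
  exact hv.null_of_subset (measurableSet_le measurable_const hX)
    (measurableSet_le measurable_const hX) (fun ω hω => hyx.le.trans hω) hy

theorem choquetQuantile_indicator_one_le {Ω : Type*} [MeasurableSpace Ω] {v : Set Ω → ℝ}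
    (hv : IsBinaryCapacity v) {A : Set Ω} (hA : MeasurableSet A) (h : v A = 0) :
    choquetQuantile v (A.indicator 1) ≤ 0 := by
  refine le_of_forall_pos_le_add fun ε hε => ?_
  rw [zero_add]
  refine choquetQuantile_le hv.1 (m := 0)
    (fun ω => Set.indicator_nonneg (fun _ _ => zero_le_one) ω) ?_
  refine hv.null_of_subset
    (measurableSet_le measurable_const (measurable_one.indicator hA)) hA (fun ω hω => ?_) h
  by_contra hn
  rw [Set.mem_ofPred_eq, Set.indicator_of_notMem hn] at hω
  linarith

/-- For a binary capacity `v`, the Choquet quantile `I_v` is convex on the bounded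
measurable functions if and only if the null set `C_v = {A ∈ F : v A = 0}` is closed
under union. -/
theorem choquetQuantile_convex_iff_nullSet_union_closed
    {Ω : Type*} [MeasurableSpace Ω] (v : Set Ω → ℝ) (hv : IsBinaryCapacity v) :
    (∀ X Y : Ω → ℝ, Measurable X → (∃ M : ℝ, ∀ ω, |X ω| ≤ M) →
        Measurable Y → (∃ M : ℝ, ∀ ω, |Y ω| ≤ M) →
        ∀ l : ℝ, l ∈ Set.Icc (0 : ℝ) 1 →
        choquetQuantile v (fun ω => l * X ω + (1 - l) * Y ω)
          ≤ l * choquetQuantile v X + (1 - l) * choquetQuantile v Y) ↔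
    (∀ A B : Set Ω, MeasurableSet A → MeasurableSet B → v A = 0 → v B = 0 →
        v (A ∪ B) = 0) := by
  constructor
  · intro hconv A B hA hB hvA hvB
    have hbdd : ∀ C : Set Ω, ∀ ω, |C.indicator (1 : Ω → ℝ) ω| ≤ 1 := fun C ω => by
      by_cases h : ω ∈ C <;> simp [h]
    have hmeas : ∀ {C : Set Ω}, MeasurableSet C → Measurable (C.indicator (1 : Ω → ℝ)) :=
      fun hC => measurable_one.indicator hC
    have hZ := hconv (A.indicator 1) (B.indicator 1) (hmeas hA) ⟨1, hbdd A⟩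
      (hmeas hB) ⟨1, hbdd B⟩ (1 / 2) (by norm_num)
    have hIA := choquetQuantile_indicator_one_le hv hA hvA
    have hIB := choquetQuantile_indicator_one_le hv hB hvB
    have hmZ : Measurable fun ω =>
        (1 / 2 : ℝ) * A.indicator 1 ω + (1 - 1 / 2) * B.indicator 1 ω :=
      ((hmeas hA).const_mul _).add ((hmeas hB).const_mul _)
    have hnull := null_of_choquetQuantile_lt hv hmZ (M := 1) (x := 1 / 2)
      (fun ω => by
        have hAω := (abs_le.mp (hbdd A ω)).2
        have hBω := (abs_le.mp (hbdd B ω)).2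
        linarith)
      (by linarith)
    refine hv.null_of_subset (hA.union hB) (measurableSet_le measurable_const hmZ) ?_ hnull
    intro ω hω
    by_cases h1 : ω ∈ A <;> by_cases h2 : ω ∈ B <;> simp_all <;> norm_num
  · rintro hunion X Y hX ⟨M, hM⟩ hY ⟨N, hN⟩ l ⟨hl0, hl1⟩
    refine le_of_forall_pos_le_add fun ε hε => ?_
    have hl1' : 0 ≤ 1 - l := sub_nonneg.mpr hl1
    set x := choquetQuantile v X + ε with hx
    set y := choquetQuantile v Y + ε with hy
    have hvX : v {ω | x ≤ X ω} = 0 :=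
      null_of_choquetQuantile_lt hv hX (fun ω => (abs_le.mp (hM ω)).2) (by linarith)
    have hvY : v {ω | y ≤ Y ω} = 0 :=
      null_of_choquetQuantile_lt hv hY (fun ω => (abs_le.mp (hN ω)).2) (by linarith)
    have hmX : MeasurableSet {ω | x ≤ X ω} := measurableSet_le measurable_const hX
    have hmY : MeasurableSet {ω | y ≤ Y ω} := measurableSet_le measurable_const hY
    have hxy : l * choquetQuantile v X + (1 - l) * choquetQuantile v Y + ε
        = l * x + (1 - l) * y := by
      rw [hx, hy]
      ring
    rw [hxy]
    refine choquetQuantile_le hv.1 (m := l * -M + (1 - l) * -N) (fun ω => ?_) ?_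
    · have hXω := (abs_le.mp (hM ω)).1
      have hYω := (abs_le.mp (hN ω)).1
      gcongr
    · refine hv.null_of_subset
        (measurableSet_le measurable_const ((hX.const_mul _).add (hY.const_mul _)))
        (hmX.union hmY) (fun ω hω => ?_) (hunion _ _ hmX hmY hvX hvY)
      by_contra hn
      simp only [Set.mem_union, Set.mem_ofPred_eq, not_or, not_le] at hn hω
      rcases hl0.eq_or_lt with rfl | hpos
      · linarith [hn.2]
      · have h1 := mul_lt_mul_of_pos_left hn.1 hpos
        have h2 := mul_le_mul_of_nonneg_left hn.2.le hl1'
        linarith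
end

section
/- Let Ω = [0,1] with F = B([0,1]) the Borel σ-algebra, and let v be a binary capacity on (Ω, F) that is continuous from above: v(A_n) → v(A) whenever (A_n) is a decreasing sequence in F with ⋂_n A_n = A. Then the Choquet quantile I_v is convex on the bounded Borel-measurable functions (I_v(λX + (1−λ)Y) ≤ λ I_v(X) + (1−λ) I_v(Y) for all λ ∈ [0,1]) if and only if there exists a nonempty finite set A ⊆ [0,1] such that I_v(X) = max_{ω ∈ A} X(ω) for every bounded Borel-measurable X : [0,1] → ℝ. -/
open MeasureTheory Set Filter

namespace IsBinaryCapacity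

theorem abs_indicator_one_le {Ω : Type*} (A : Set Ω) (ω : Ω) : |A.indicator (1 : Ω → ℝ) ω| ≤ 1 := by
  by_cases h : ω ∈ A <;> simp [h]

section Basic

variable {Ω : Type*} [MeasurableSpace Ω] {v : Set Ω → ℝ}

theorem mono_null (hv : IsBinaryCapacity v) {A B : Set Ω} (hA : MeasurableSet A)
    (hB : MeasurableSet B) (hAB : A ⊆ B) (h : v B = 0) : v A = 0 := by
  have := hv.1.2.2 hA hB hAB
  rcases hv.2 A hA with h' | h' <;> linarith

theorem mono_one (hv : IsBinaryCapacity v) {A B : Set Ω} (hA : MeasurableSet A)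
    (hB : MeasurableSet B) (hAB : A ⊆ B) (h : v A = 1) : v B = 1 := by
  have := hv.1.2.2 hA hB hAB
  rcases hv.2 B hB with h' | h' <;> linarith

theorem choquetQuantile_le (hv : IsBinaryCapacity v) {X : Ω → ℝ} {M c : ℝ}
    (hM : ∀ ω, |X ω| ≤ M) (h : v {ω | c ≤ X ω} = 0) : choquetQuantile v X ≤ c := by
  refine csInf_le ⟨-M, fun x hx => ?_⟩ h
  by_contra! hlt
  have huniv : {ω | x ≤ X ω} = Set.univ :=
    Set.eq_univ_of_forall fun ω => hlt.le.trans (abs_le.1 (hM ω)).1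
  rw [Set.mem_ofPred_eq, huniv, hv.1.2.1] at hx
  exact one_ne_zero hx

theorem le_choquetQuantile (hv : IsBinaryCapacity v) {X : Ω → ℝ} (hX : Measurable X)
    {M c : ℝ} (hM : ∀ ω, |X ω| ≤ M) (h : v {ω | c ≤ X ω} = 1) :
    c ≤ choquetQuantile v X := by
  refine le_csInf ⟨M + 1, ?_⟩ fun x hx => ?_
  · have hempty : {ω | M + 1 ≤ X ω} = ∅ := by
      ext ω
      simpa using (abs_le.1 (hM ω)).2.trans_lt (lt_add_one M)
    rw [Set.mem_ofPred_eq, hempty, hv.1.1]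
  · by_contra! hlt
    have h1 : v {ω | x ≤ X ω} = 1 :=
      hv.mono_one (measurableSet_le measurable_const hX) (measurableSet_le measurable_const hX)
        (fun ω hω => hlt.le.trans hω) h
    exact one_ne_zero (h1.symm.trans hx)

theorem choquetQuantile_indicator_le_zero (hv : IsBinaryCapacity v) {A : Set Ω}
    (hA : MeasurableSet A) (h : v A = 0) : choquetQuantile v (A.indicator 1) ≤ 0 := by
  refine le_of_forall_gt_imp_ge_of_dense fun x hx => ?_
  refine hv.choquetQuantile_le (abs_indicator_one_le A) (hv.mono_null
    (measurableSet_le measurable_const (measurable_one.indicator hA)) hA (fun ω hω => ?_) h)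
  by_contra hn
  rw [Set.mem_ofPred_eq, Set.indicator_of_notMem hn] at hω
  exact hx.not_ge hω

theorem null_union_of_midpoint_convex (hv : IsBinaryCapacity v)
    (hconv : ∀ X Y : Ω → ℝ, Measurable X → (∃ M : ℝ, ∀ ω, |X ω| ≤ M) →
      Measurable Y → (∃ M : ℝ, ∀ ω, |Y ω| ≤ M) →
      choquetQuantile v (fun ω => (1 / 2) * X ω + (1 - 1 / 2) * Y ω)
        ≤ (1 / 2) * choquetQuantile v X + (1 - 1 / 2) * choquetQuantile v Y)
    {A B : Set Ω} (hA : MeasurableSet A) (hB : MeasurableSet B) (hA0 : v A = 0)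
    (hB0 : v B = 0) : v (A ∪ B) = 0 := by
  refine (hv.2 _ (hA.union hB)).resolve_right fun h1 => ?_
  have mA : Measurable (A.indicator (1 : Ω → ℝ)) := measurable_one.indicator hA
  have mB : Measurable (B.indicator (1 : Ω → ℝ)) := measurable_one.indicator hB
  have hle := hconv _ _ mA ⟨1, abs_indicator_one_le A⟩ mB ⟨1, abs_indicator_one_le B⟩
  have mZ : Measurable fun ω => (1 / 2 : ℝ) * A.indicator 1 ω + (1 - 1 / 2) * B.indicator 1 ω :=
    (mA.const_mul _).add (mB.const_mul _)
  have hge : (1 / 2 : ℝ) ≤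
      choquetQuantile v fun ω => (1 / 2) * A.indicator 1 ω + (1 - 1 / 2) * B.indicator 1 ω := by
    refine hv.le_choquetQuantile mZ (M := 1) (fun ω => ?_)
      (hv.mono_one (hA.union hB) (measurableSet_le measurable_const mZ) (fun ω hω => ?_) h1)
    · have ha := abs_le.1 (abs_indicator_one_le A ω)
      have hb := abs_le.1 (abs_indicator_one_le B ω)
      exact abs_le.2 ⟨by linarith, by linarith⟩
    · by_cases ha : ω ∈ A <;> by_cases hb : ω ∈ B <;> simp_all <;> norm_num
  linarith [hv.choquetQuantile_indicator_le_zero hA hA0,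
    hv.choquetQuantile_indicator_le_zero hB hB0]

theorem exists_null_of_iInter_null (hv : IsBinaryCapacity v)
    (hcont : ∀ A : ℕ → Set Ω, (∀ n, MeasurableSet (A n)) →
      Antitone A → Tendsto (fun n => v (A n)) atTop (nhds (v (⋂ n, A n))))
    {A : ℕ → Set Ω} (hA : ∀ n, MeasurableSet (A n)) (hanti : Antitone A)
    (h : v (⋂ n, A n) = 0) : ∃ n, v (A n) = 0 := by
  have ht := hcont A hA hanti
  rw [h] at ht
  obtain ⟨n, hn⟩ := (ht.eventually (gt_mem_nhds one_pos)).exists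
  exact ⟨n, (hv.2 _ (hA n)).resolve_right hn.ne⟩

theorem choquetQuantile_eq_sup' {A : Finset Ω} (hA : A.Nonempty)
    (hnull : ∀ B : Set Ω, MeasurableSet B → (v B = 0 ↔ ∀ a ∈ A, a ∉ B))
    {X : Ω → ℝ} (hX : Measurable X) : choquetQuantile v X = A.sup' hA X := by
  have : {x : ℝ | v {ω | x ≤ X ω} = 0} = Set.Ioi (A.sup' hA X) := by
    ext x
    rw [Set.mem_ofPred_eq, hnull _ (measurableSet_le measurable_const hX)]
    simp
  rw [choquetQuantile, this, csInf_Ioi]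

theorem finite_setOf_singleton_eq_one [MeasurableSingletonClass Ω] (hv : IsBinaryCapacity v)
    (hcont : ∀ A : ℕ → Set Ω, (∀ n, MeasurableSet (A n)) →
      Antitone A → Tendsto (fun n => v (A n)) atTop (nhds (v (⋂ n, A n)))) :
    {ω | v {ω} = 1}.Finite := by
  by_contra hinf
  let f := Set.Infinite.natEmbedding _ hinf
  let C : ℕ → Set Ω := fun n => (fun k => (f k : Ω)) '' Set.Ici n
  have hC : ∀ n, MeasurableSet (C n) := fun n => ((Set.to_countable _).image _).measurableSet
  have hempty : ⋂ n, C n = ∅ := by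
    refine Set.eq_empty_of_forall_notMem fun ω hω => ?_
    rw [Set.mem_iInter] at hω
    obtain ⟨k, -, rfl⟩ := hω 0
    obtain ⟨m, hm, hmk⟩ := hω (k + 1)
    have : m = k := f.injective (Subtype.ext hmk)
    rw [Set.mem_Ici] at hm
    omega
  obtain ⟨n, hn⟩ := hv.exists_null_of_iInter_null hcont hC
    (fun m n hmn => Set.image_mono (Set.Ici_subset_Ici.2 hmn)) (by rw [hempty, hv.1.1])
  have h1 : v (C n) = 1 := hv.mono_one (measurableSet_singleton _) (hC n)
    (Set.singleton_subset_iff.2 ⟨n, Set.self_mem_Ici, rfl⟩) (f n).2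
  exact one_ne_zero (h1.symm.trans hn)

end Basic

theorem null_of_forall_singleton_null {Ω : Type*} [MetricSpace Ω] [CompactSpace Ω]
    [MeasurableSpace Ω] [BorelSpace Ω] {v : Set Ω → ℝ} (hv : IsBinaryCapacity v)
    (hcont : ∀ A : ℕ → Set Ω, (∀ n, MeasurableSet (A n)) →
      Antitone A → Tendsto (fun n => v (A n)) atTop (nhds (v (⋂ n, A n))))
    (hunion : ∀ A B : Set Ω, MeasurableSet A → MeasurableSet B → v A = 0 → v B = 0 →
      v (A ∪ B) = 0)
    {D : Set Ω} (hD : MeasurableSet D) (hsing : ∀ ω ∈ D, v {ω} = 0) : v D = 0 := by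
  obtain ⟨t, ht, hsub, h0⟩ : ∃ t, MeasurableSet t ∧ Set.univ ⊆ t ∧ v (t ∩ D) = 0 := by
    refine isCompact_univ.induction_on (p := fun s => ∃ t, MeasurableSet t ∧ s ⊆ t ∧ v (t ∩ D) = 0)
      ⟨∅, MeasurableSet.empty, subset_rfl, by rw [Set.empty_inter, hv.1.1]⟩ ?_ ?_ ?_
    · rintro s s' hss ⟨t, ht, hst, h⟩
      exact ⟨t, ht, hss.trans hst, h⟩
    · rintro s s' ⟨t, ht, hst, h⟩ ⟨t', ht', hst', h'⟩
      refine ⟨t ∪ t', ht.union ht', Set.union_subset_union hst hst', ?_⟩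
      rw [Set.union_inter_distrib_right]
      exact hunion _ _ (ht.inter hD) (ht'.inter hD) h h'
    · intro ω _
      let C : ℕ → Set Ω := fun n => Metric.closedBall ω (1 / (n + 1)) ∩ D
      have hC : ∀ n, MeasurableSet (C n) := fun n => measurableSet_closedBall.inter hD
      have hsub : ⋂ n, C n ⊆ {ω} ∩ D := by
        intro x hx
        rw [Set.mem_iInter] at hx
        refine ⟨dist_le_zero.1 ?_, (hx 0).2⟩
        exact ge_of_tendsto' tendsto_one_div_add_atTop_nhds_zero_nat fun n => (hx n).1
      have hnull : v ({ω} ∩ D) = 0 := by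
        by_cases hω : ω ∈ D
        · rw [Set.inter_eq_left.2 (Set.singleton_subset_iff.2 hω), hsing ω hω]
        · rw [Set.singleton_inter_eq_empty.2 hω, hv.1.1]
      obtain ⟨n, hn⟩ := hv.exists_null_of_iInter_null hcont hC
        (fun m n hmn => Set.inter_subset_inter_left _
          (Metric.closedBall_subset_closedBall (Nat.one_div_le_one_div hmn)))
        (hv.mono_null (MeasurableSet.iInter hC) ((measurableSet_singleton ω).inter hD) hsub hnull)
      exact ⟨_, mem_nhdsWithin_of_mem_nhds (Metric.closedBall_mem_nhds ω Nat.one_div_pos_of_nat),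
        _, measurableSet_closedBall, subset_rfl, hn⟩
  rwa [Set.univ_subset_iff.1 hsub, Set.univ_inter] at h0

theorem exists_finset_null_iff {Ω : Type*} [MetricSpace Ω] [CompactSpace Ω]
    [MeasurableSpace Ω] [BorelSpace Ω] {v : Set Ω → ℝ} (hv : IsBinaryCapacity v)
    (hcont : ∀ A : ℕ → Set Ω, (∀ n, MeasurableSet (A n)) →
      Antitone A → Tendsto (fun n => v (A n)) atTop (nhds (v (⋂ n, A n))))
    (hunion : ∀ A B : Set Ω, MeasurableSet A → MeasurableSet B → v A = 0 → v B = 0 →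
      v (A ∪ B) = 0) :
    ∃ A : Finset Ω, A.Nonempty ∧
      ∀ B : Set Ω, MeasurableSet B → (v B = 0 ↔ ∀ a ∈ A, a ∉ B) := by
  have hfin := hv.finite_setOf_singleton_eq_one hcont
  have hiff : ∀ B : Set Ω, MeasurableSet B → (v B = 0 ↔ ∀ a ∈ hfin.toFinset, a ∉ B) := by
    refine fun B hB => ⟨fun h a ha haB => ?_, fun h => ?_⟩
    · have h0 := hv.mono_null (measurableSet_singleton a) hB (Set.singleton_subset_iff.2 haB) h
      exact one_ne_zero ((hfin.mem_toFinset.1 ha).symm.trans h0)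
    · exact hv.null_of_forall_singleton_null hcont hunion hB fun ω hω =>
        (hv.2 _ (measurableSet_singleton ω)).resolve_right fun h1 =>
          h ω (hfin.mem_toFinset.2 h1) hω
  refine ⟨hfin.toFinset, ?_, hiff⟩
  by_contra hne
  rw [Finset.not_nonempty_iff_eq_empty] at hne
  have h0 : v Set.univ = 0 := (hiff _ MeasurableSet.univ).2 (by simp [hne])
  exact one_ne_zero (hv.1.2.1.symm.trans h0)

end IsBinaryCapacity

/-- On `Ω = [0,1]` with the Borel σ-algebra, for a binary capacity `v` continuous from
above, the Choquet quantile `I_v` is convex on the bounded Borel functions if and only if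
there exists a nonempty finite set `A ⊆ [0,1]` with `I_v X = max_{ω ∈ A} X ω` for every
bounded Borel `X`. -/
theorem continuous_binaryCapacity_convex_iff_finite_max
    (v : Set (Set.Icc (0 : ℝ) 1) → ℝ) (hv : IsBinaryCapacity v)
    (hcont : ∀ A : ℕ → Set (Set.Icc (0 : ℝ) 1), (∀ n, MeasurableSet (A n)) →
      Antitone A → Tendsto (fun n => v (A n)) atTop (nhds (v (⋂ n, A n)))) :
    (∀ X Y : Set.Icc (0 : ℝ) 1 → ℝ, Measurable X → (∃ M : ℝ, ∀ ω, |X ω| ≤ M) →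
        Measurable Y → (∃ M : ℝ, ∀ ω, |Y ω| ≤ M) →
        ∀ l : ℝ, l ∈ Set.Icc (0 : ℝ) 1 →
        choquetQuantile v (fun ω => l * X ω + (1 - l) * Y ω)
          ≤ l * choquetQuantile v X + (1 - l) * choquetQuantile v Y) ↔
    (∃ (A : Finset (Set.Icc (0 : ℝ) 1)) (hA : A.Nonempty),
      ∀ X : Set.Icc (0 : ℝ) 1 → ℝ, Measurable X → (∃ M : ℝ, ∀ ω, |X ω| ≤ M) →
        choquetQuantile v X = A.sup' hA X) := by
  constructor
  · intro hconv
    obtain ⟨A, hA, hnull⟩ := hv.exists_finset_null_iff hcont fun _ _ hA hB =>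
      hv.null_union_of_midpoint_convex
        (fun X Y hX hXb hY hYb => hconv X Y hX hXb hY hYb (1 / 2) ⟨by norm_num, by norm_num⟩) hA hB
    exact ⟨A, hA, fun X hX _ => IsBinaryCapacity.choquetQuantile_eq_sup' hA hnull hX⟩
  · rintro ⟨A, hA, hmax⟩ X Y hX ⟨M, hM⟩ hY ⟨K, hK⟩ l ⟨hl0, hl1⟩
    have hl1' : 0 ≤ 1 - l := sub_nonneg.2 hl1
    have hbdd : ∀ ω, |l * X ω + (1 - l) * Y ω| ≤ l * M + (1 - l) * K := fun ω => by
      refine (abs_add_le _ _).trans ?_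
      rw [abs_mul, abs_mul, abs_of_nonneg hl0, abs_of_nonneg hl1']
      gcongr
      exacts [hM ω, hK ω]
    have hmeas : Measurable fun ω => l * X ω + (1 - l) * Y ω :=
      (hX.const_mul l).add (hY.const_mul (1 - l))
    rw [hmax X hX ⟨M, hM⟩, hmax Y hY ⟨K, hK⟩, hmax _ hmeas ⟨_, hbdd⟩]
    refine Finset.sup'_le _ _ fun a ha => ?_
    have hXa := Finset.le_sup' X ha
    have hYa := Finset.le_sup' Y ha
    gcongr
end

section
/- Let (Ω, F) be a measurable space, w a capacity on (Ω, F), and X : Ω → ℝ bounded and F-measurable. Then the Choquet integral of X with respect to w equals the integral of its Choquet quantile functions over levels: ∫ X dw = ∫_0^1 Q^w_α(X) dα = ∫_0^1 Q̄^w_α(X) dα (the maps α ↦ Q^w_α(X) and α ↦ Q̄^w_α(X) are monotone and bounded on (0,1), hence Lebesgue integrable). -/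
open MeasureTheory Set

/-- If `g` is antitone, equal to `1` below `-M` and to `0` above `M`, then any generalized
inverse `Q` of `1 - g` on `(0, 1)` has integral `∫ x in -M..M, g x - M`. -/
theorem integral_generalizedInverse {g Q : ℝ → ℝ} {M : ℝ} (hM : 0 < M) (hg : Antitone g)
    (hg1 : ∀ x ≤ -M, g x = 1) (hg0 : ∀ x ≥ M, g x = 0)
    (h1 : ∀ α ∈ Ioo (0 : ℝ) 1, ∀ x, x < Q α → 1 - α ≤ g x)
    (h2 : ∀ α ∈ Ioo (0 : ℝ) 1, ∀ x, 1 - α < g x → x ≤ Q α) :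
    ∫ α in (0 : ℝ)..1, Q α = (∫ x in (-M)..M, g x) - M := by
  have hmono : MonotoneOn Q (Ioo 0 1) := by
    intro α hα β hβ hαβ
    rcases hαβ.eq_or_lt with rfl | hlt
    · exact le_rfl
    · refine le_of_forall_lt fun x hx => ?_
      obtain ⟨y, hxy, hy⟩ := exists_between hx
      exact hxy.trans_le (h2 β hβ y (by linarith [h1 α hα y hy]))
  have hlow : ∀ α ∈ Ioo (0 : ℝ) 1, -M ≤ Q α := fun α hα =>
    h2 α hα _ (by rw [hg1 _ le_rfl]; linarith [hα.1])
  have hupp : ∀ α ∈ Ioo (0 : ℝ) 1, Q α ≤ M := fun α hα => by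
    by_contra! h
    have := h1 α hα M h
    rw [hg0 M le_rfl] at this
    linarith [hα.2]
  set μ : Measure ℝ := volume.restrict (Ioo 0 1) with hμ
  have hμ1 : μ.real univ = 1 := by simp [hμ, Measure.real]
  have hint : Integrable Q μ := by
    refine Integrable.of_bound
      (aemeasurable_restrict_of_monotoneOn measurableSet_Ioo hmono).aestronglyMeasurable M ?_
    filter_upwards [ae_restrict_mem measurableSet_Ioo] with α hα
    exact abs_le.2 ⟨hlow α hα, hupp α hα⟩
  have hrange : ∀ x, 0 ≤ g x ∧ g x ≤ 1 := fun x => by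
    constructor
    · rw [← hg0 (max x M) (le_max_right _ _)]
      exact hg (le_max_left _ _)
    · rw [← hg1 (min x (-M)) (min_le_right _ _)]
      exact hg (min_le_left _ _)
  have hIoo : ∀ x, μ.real (Ioo (1 - g x) 1) = g x := fun x => by
    rw [hμ, measureReal_restrict_apply measurableSet_Ioo, Ioo_inter_Ioo,
      Real.volume_real_Ioo]
    have := hrange x
    rw [min_self, max_eq_left (a := 1 - g x) (by linarith), sub_sub_cancel,
      max_eq_left this.1]
  have hIco : ∀ x, μ.real (Ico (1 - g x) 1) = g x := fun x =>
    (congrArg ENNReal.toReal (measure_congr Ioo_ae_eq_Ico.symm)).trans (hIoo x)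
  have hcake : ∫ α, (Q α + M) ∂μ = ∫ t in Ioc 0 (2 * M), g (t - M) := by
    have hint' : Integrable (fun α => Q α + M) μ := hint.add (integrable_const M)
    rw [hint'.integral_eq_integral_Ioc_meas_le (M := 2 * M)]
    · refine integral_congr_ae (ae_restrict_of_ae ?_)
      filter_upwards [meas_le_ae_eq_meas_lt μ volume (fun α => Q α + M)] with t ht
      apply le_antisymm
      · calc μ.real {α | t ≤ Q α + M} = μ.real {α | t < Q α + M} := congrArg ENNReal.toReal ht
          _ ≤ μ.real (Ico (1 - g (t - M)) 1) := by
            refine ENNReal.toReal_mono (measure_ne_top _ _) (measure_mono_ae ?_)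
            filter_upwards [ae_restrict_mem measurableSet_Ioo] with α hα h
            exact ⟨by linarith [h1 α hα (t - M) (by
              have h' : t < Q α + M := h
              linarith)], hα.2⟩
          _ = g (t - M) := hIco _
      · calc g (t - M) = μ.real (Ioo (1 - g (t - M)) 1) := (hIoo _).symm
          _ ≤ μ.real {α | t ≤ Q α + M} := by
            refine ENNReal.toReal_mono (measure_ne_top _ _) (measure_mono_ae ?_)
            filter_upwards [ae_restrict_mem measurableSet_Ioo] with α hα h
            have h' : 1 - g (t - M) < α := h.1
            show t ≤ Q α + M
            linarith [h2 α hα (t - M) (by linarith)]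
    · filter_upwards [ae_restrict_mem measurableSet_Ioo] with α hα
      show 0 ≤ Q α + M
      linarith [hlow α hα]
    · filter_upwards [ae_restrict_mem measurableSet_Ioo] with α hα
      show Q α + M ≤ 2 * M
      linarith [hupp α hα]
  rw [integral_add hint (integrable_const M), integral_const, hμ1, one_smul,
    ← intervalIntegral.integral_of_le (by linarith),
    intervalIntegral.integral_comp_sub_right (fun x => g x), zero_sub,
    show 2 * M - M = M by ring] at hcake
  rw [intervalIntegral.integral_of_le zero_le_one, integral_Ioc_eq_integral_Ioo]
  linarith

/-- The two-sided improper integral of an antitone `g` equal to `1` below `-M` and to `0` above `M`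
reduces to an integral over `[-M, M]`. -/
theorem integral_Iio_sub_one_add_integral_Ioi {g : ℝ → ℝ} {M : ℝ} (hM : 0 < M) (hg : Antitone g)
    (hg1 : ∀ x ≤ -M, g x = 1) (hg0 : ∀ x ≥ M, g x = 0) :
    (∫ x in Iio (0 : ℝ), (g x - 1)) + ∫ x in Ioi (0 : ℝ), g x = (∫ x in (-M)..M, g x) - M := by
  have hneg : ∫ x in Iio (0 : ℝ), (g x - 1) = ∫ x in (-M)..0, (g x - 1) := by
    rw [intervalIntegral.integral_of_le (by linarith), integral_Ioc_eq_integral_Ioo]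
    refine setIntegral_eq_of_subset_of_forall_sdiff_eq_zero measurableSet_Iio
      (fun x hx => hx.2) fun x hx => ?_
    rw [hg1 x (not_lt.1 fun h => hx.2 ⟨h, hx.1⟩), sub_self]
  have hpos : ∫ x in Ioi (0 : ℝ), g x = ∫ x in (0 : ℝ)..M, g x := by
    rw [intervalIntegral.integral_of_le hM.le]
    refine setIntegral_eq_of_subset_of_forall_sdiff_eq_zero measurableSet_Ioi
      (fun x hx => hx.1) fun x hx => ?_
    exact hg0 x (not_lt.1 fun h => hx.2 ⟨hx.1, h.le⟩)
  rw [hneg, hpos, intervalIntegral.integral_sub hg.intervalIntegrable (by simp),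
    ← intervalIntegral.integral_add_adjacent_intervals (hg.intervalIntegrable (a := -M) (b := 0))
      (hg.intervalIntegrable (a := 0) (b := M))]
  simp
  ring

/-- For a capacity `w` and bounded measurable `X`, the Choquet integral equals the
integral over levels of the left (and of the right) Choquet quantile functions:
`∫ X dw = ∫_0^1 Q^w_α(X) dα = ∫_0^1 Q̄^w_α(X) dα`. -/
theorem choquetIntegral_eq_integral_of_quantiles {Ω : Type*} [MeasurableSpace Ω]
    (w : Set Ω → ℝ) (hw : IsCapacity w)
    (X : Ω → ℝ) (hX : Measurable X) (hXb : ∃ M : ℝ, ∀ ω, |X ω| ≤ M) :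
    choquetIntegral w X = ∫ α in (0 : ℝ)..1, leftQuantile w α X ∧
    choquetIntegral w X = ∫ α in (0 : ℝ)..1, rightQuantile w α X := by
  obtain ⟨hw0, hw1, hwm⟩ := hw
  obtain ⟨B, hB⟩ := hXb
  obtain ⟨M, hM, hXM⟩ : ∃ M : ℝ, 0 < M ∧ ∀ ω, -M < X ω ∧ X ω < M :=
    ⟨|B| + 1, by positivity, fun ω => abs_lt.1 (by linarith [hB ω, le_abs_self B])⟩
  set g : ℝ → ℝ := fun x => w {ω | x ≤ X ω} with hgdef
  have hg : Antitone g := fun x y hxy =>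
    hwm (measurableSet_le measurable_const hX) (measurableSet_le measurable_const hX)
      fun ω hω => hxy.trans hω
  have hg1 : ∀ x ≤ -M, g x = 1 := fun x hx => by
    rw [← hw1]
    exact congrArg w (eq_univ_of_forall fun ω => hx.trans (hXM ω).1.le)
  have hg0 : ∀ x ≥ M, g x = 0 := fun x hx => by
    rw [← hw0]
    exact congrArg w (eq_empty_of_forall_notMem fun ω hω =>
      ((hXM ω).2.trans_le (hx.trans hω)).false)
  have hC : choquetIntegral w X = (∫ x in (-M)..M, g x) - M :=
    integral_Iio_sub_one_add_integral_Ioi hM hg hg1 hg0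
  rw [hC]
  constructor
  · refine (integral_generalizedInverse hM hg hg1 hg0 (fun α hα x hx => ?_)
      fun α hα x hx => ?_).symm
    · by_contra! h
      refine (hx.trans_le (csInf_le ⟨-M, fun y hy => ?_⟩ h.le)).false
      by_contra! hlt
      have hy' : g y ≤ 1 - α := hy
      rw [hg1 y hlt.le] at hy'
      linarith [hα.1]
    · refine le_csInf ⟨M, ?_⟩ fun y hy => ?_
      · show g M ≤ 1 - α
        rw [hg0 M le_rfl]
        linarith [hα.2]
      · by_contra! hlt
        have hy' : g y ≤ 1 - α := hy
        linarith [hg hlt.le]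
  · refine (integral_generalizedInverse hM hg hg1 hg0 (fun α hα x hx => ?_)
      fun α hα x hx => ?_).symm
    · by_contra! h
      refine (hx.trans_le (csInf_le ⟨-M, fun y hy => ?_⟩ h)).false
      by_contra! hlt
      have hy' : g y < 1 - α := hy
      rw [hg1 y hlt.le] at hy'
      linarith [hα.1]
    · refine le_csInf ⟨M, ?_⟩ fun y hy => ?_
      · show g M < 1 - α
        rw [hg0 M le_rfl]
        linarith [hα.2]
      · by_contra! hlt
        have hy' : g y < 1 - α := hy
        linarith [hg hlt.le]
end

section
/- Let (Ω, F) be a measurable space, let v_1, …, v_n be binary capacities on (Ω, F), and define C = {A ∈ F : A = ⋃_{i=1}^n A_i for some A_1, …, A_n ∈ F with v_i(A_i) = 0 for each i}. (1) If Ω ∉ C, then the function v : F → ℝ with v(A) = 0 for A ∈ C and v(A) = 1 otherwise is a binary capacity with null set C, and for every bounded F-measurable X : Ω → ℝ the inf-convolution of I_{v_1}, …, I_{v_n} at X equals I_v(X): inf{∑_{i=1}^n I_{v_i}(X_i) : (X_1,…,X_n) is an allocation of X} = inf{x ∈ ℝ : {ω : X(ω) > x} ∈ C}. (2) If Ω ∈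 C, then for every bounded F-measurable X and every c ∈ ℝ there exists an allocation (X_1,…,X_n) of X with ∑_{i=1}^n I_{v_i}(X_i) ≤ c. -/
open MeasureTheory Set
open scoped Classical

/-- The measurable sets that are unions of a `v i`-null set for each `i`. -/
def jointNullSets {Ω : Type*} [MeasurableSpace Ω] {n : ℕ}
    (v : Fin n → Set Ω → ℝ) : Set (Set Ω) :=
  {A : Set Ω | ∃ As : Fin n → Set Ω,
    (∀ i, MeasurableSet (As i)) ∧ (∀ i, v i (As i) = 0) ∧ A = ⋃ i, As i}

namespace IsBinaryCapacity

variable {Ω : Type*} [MeasurableSpace Ω] {w : Set Ω → ℝ}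

lemma null_of_subset_s10 (hw : IsBinaryCapacity w) {A B : Set Ω} (hA : MeasurableSet A)
    (hB : MeasurableSet B) (hAB : A ⊆ B) (h : w B = 0) : w A = 0 := by
  have hle := hw.1.2.2 hA hB hAB
  rcases hw.2 A hA with h0 | h1
  · exact h0
  · linarith

lemma neg_le_of_null (hw : IsBinaryCapacity w) {X : Ω → ℝ} {M t : ℝ}
    (hM : ∀ ω, |X ω| ≤ M) (ht : w {ω | t ≤ X ω} = 0) : -M ≤ t := by
  by_contra! hlt
  have huniv : {ω | t ≤ X ω} = Set.univ :=
    Set.eq_univ_of_forall fun ω => hlt.le.trans (abs_le.1 (hM ω)).1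
  rw [huniv, hw.1.2.1] at ht
  exact one_ne_zero ht

lemma choquetQuantile_le_s10 (hw : IsBinaryCapacity w) {X : Ω → ℝ}
    (hX : ∃ M : ℝ, ∀ ω, |X ω| ≤ M) {t : ℝ} (ht : w {ω | t ≤ X ω} = 0) :
    choquetQuantile w X ≤ t := by
  obtain ⟨M, hM⟩ := hX
  exact csInf_le ⟨-M, fun s hs => hw.neg_le_of_null hM hs⟩ ht

lemma exists_null_lt (hw : IsBinaryCapacity w) {X : Ω → ℝ}
    (hX : ∃ M : ℝ, ∀ ω, |X ω| ≤ M) {ε : ℝ} (hε : 0 < ε) :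
    ∃ t, w {ω | t ≤ X ω} = 0 ∧ t < choquetQuantile w X + ε := by
  obtain ⟨M, hM⟩ := hX
  have hne : {t : ℝ | w {ω | t ≤ X ω} = 0}.Nonempty := by
    refine ⟨M + 1, ?_⟩
    have hempty : {ω | M + 1 ≤ X ω} = ∅ :=
      Set.eq_empty_of_forall_notMem fun ω (hω : M + 1 ≤ X ω) => by
        linarith [(abs_le.1 (hM ω)).2]
    rw [Set.mem_ofPred_eq, hempty, hw.1.1]
  exact exists_lt_of_csInf_lt hne (lt_add_of_pos_right _ hε)

end IsBinaryCapacity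

section JointNullSets

variable {Ω : Type*} [MeasurableSpace Ω] {n : ℕ} {v : Fin n → Set Ω → ℝ}

lemma measurableSet_of_mem_jointNullSets {A : Set Ω} (hA : A ∈ jointNullSets v) :
    MeasurableSet A := by
  obtain ⟨As, hm, -, rfl⟩ := hA
  exact MeasurableSet.iUnion hm

lemma empty_mem_jointNullSets (hv : ∀ i, IsBinaryCapacity (v i)) : ∅ ∈ jointNullSets v :=
  ⟨fun _ => ∅, fun _ => MeasurableSet.empty, fun i => (hv i).1.1, by simp⟩

lemma mem_jointNullSets_of_subset (hv : ∀ i, IsBinaryCapacity (v i)) {A B : Set Ω}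
    (hA : MeasurableSet A) (hAB : A ⊆ B) (hB : B ∈ jointNullSets v) : A ∈ jointNullSets v := by
  obtain ⟨Bs, hm, h0, rfl⟩ := hB
  refine ⟨fun i => A ∩ Bs i, fun i => hA.inter (hm i), fun i => ?_, ?_⟩
  · exact (hv i).null_of_subset_s10 (hA.inter (hm i)) (hm i) Set.inter_subset_right (h0 i)
  · rw [← Set.inter_iUnion, Set.inter_eq_left.2 hAB]

lemma isBinaryCapacity_jointNullSets (hv : ∀ i, IsBinaryCapacity (v i))
    (huniv : Set.univ ∉ jointNullSets v) :
    IsBinaryCapacity (fun A : Set Ω => if A ∈ jointNullSets v then (0 : ℝ) else 1) := by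
  refine ⟨⟨if_pos (empty_mem_jointNullSets hv), if_neg huniv, fun A B hA _ hAB => ?_⟩,
    fun A _ => ?_⟩
  · by_cases hB : B ∈ jointNullSets v
    · simp [hB, mem_jointNullSets_of_subset hv hA hAB hB]
    · simp only [hB, if_false]
      split_ifs <;> norm_num
  · by_cases hA : A ∈ jointNullSets v <;> simp [hA]

/-- Weights that split the unit mass at a point equally among the sets `A i` containing it,
and equally among all indices if there is no such set. -/
lemma exists_measurable_weights (hn : 0 < n) {A : Fin n → Set Ω}
    (hA : ∀ i, MeasurableSet (A i)) :
    ∃ g : Fin n → Ω → ℝ, (∀ i, Measurable (g i)) ∧ (∀ i ω, 0 ≤ g i ω) ∧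
      (∀ ω, ∑ i, g i ω = 1) ∧ ∀ i, ∀ ω ∈ ⋃ j, A j, ω ∉ A i → g i ω = 0 := by
  let N : Ω → ℝ := fun ω => ∑ j, (A j).indicator 1 ω
  have hind : ∀ i ω, (0 : ℝ) ≤ (A i).indicator 1 ω := fun i ω =>
    Set.indicator_nonneg (fun _ _ => zero_le_one) ω
  have hmeas : ∀ i, Measurable ((A i).indicator (1 : Ω → ℝ)) := fun i =>
    measurable_one.indicator (hA i)
  refine ⟨fun i ω => if ω ∈ ⋃ j, A j then (A i).indicator 1 ω / N ω else 1 / n,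
    fun i => ?_, fun i ω => ?_, fun ω => ?_, fun i ω hω hi => ?_⟩
  · exact Measurable.ite (MeasurableSet.iUnion hA)
      ((hmeas i).div (Finset.measurable_fun_sum _ fun j _ => hmeas j)) measurable_const
  · dsimp only
    split_ifs
    · exact div_nonneg (hind i ω) (Finset.sum_nonneg fun j _ => hind j ω)
    · positivity
  · by_cases hω : ω ∈ ⋃ j, A j
    · simp only [hω, if_true, ← Finset.sum_div]
      refine div_self (ne_of_gt ?_)
      obtain ⟨j, hj⟩ := Set.mem_iUnion.1 hω
      exact Finset.sum_pos' (fun j _ => hind j ω) ⟨j, Finset.mem_univ j, by simp [hj]⟩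
    · have hn' : (n : ℝ) ≠ 0 := by positivity
      simp [hω, hn']
  · simp [hω, hi]

/-- The total risk `x` is achievable as soon as `{X > x}` is a union of null sets. -/
lemma exists_allocation_sum_choquetQuantile_le (hn : 0 < n)
    (hv : ∀ i, IsBinaryCapacity (v i)) {X : Ω → ℝ} (hX : Measurable X)
    (hXb : ∃ M : ℝ, ∀ ω, |X ω| ≤ M) {x : ℝ} (hx : {ω | x < X ω} ∈ jointNullSets v) :
    ∃ Xs : Fin n → Ω → ℝ,
      (∀ i, Measurable (Xs i)) ∧ (∀ i, ∃ M : ℝ, ∀ ω, |Xs i ω| ≤ M) ∧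
      (∀ ω, ∑ i, Xs i ω = X ω) ∧ ∑ i, choquetQuantile (v i) (Xs i) ≤ x := by
  obtain ⟨A, hA, hA0, hAx⟩ := hx
  obtain ⟨g, hg, hg0, hg1, hgA⟩ := exists_measurable_weights hn hA
  obtain ⟨M, hM⟩ := hXb
  have hn' : (n : ℝ) ≠ 0 := by positivity
  have hm : ∀ i, Measurable fun ω => x / n + (X ω - x) * g i ω := fun i =>
    ((hX.sub measurable_const).mul (hg i)).const_add _
  have hb : ∀ i, ∃ K : ℝ, ∀ ω, |x / n + (X ω - x) * g i ω| ≤ K := fun i => by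
    refine ⟨|x / n| + (M + |x|) * 1, fun ω => (abs_add_le _ _).trans ?_⟩
    have hle : g i ω ≤ 1 :=
      (Finset.single_le_sum (fun j _ => hg0 j ω) (Finset.mem_univ i)).trans_eq (hg1 ω)
    have hXx : |X ω - x| ≤ M + |x| := (abs_sub _ _).trans (by gcongr; exact hM ω)
    rw [abs_mul, abs_of_nonneg (hg0 i ω)]
    gcongr
    · exact hg0 i ω
    · exact (abs_nonneg _).trans hXx
  refine ⟨fun i ω => x / n + (X ω - x) * g i ω, hm, hb, fun ω => ?_, ?_⟩
  · rw [Finset.sum_add_distrib, ← Finset.mul_sum, hg1]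
    simp [mul_div_cancel₀, hn']
  · have hle : ∀ i, choquetQuantile (v i) (fun ω => x / n + (X ω - x) * g i ω) ≤ x / n := by
      refine fun i => le_of_forall_pos_le_add fun ε hε => (hv i).choquetQuantile_le_s10 (hb i) ?_
      refine (hv i).null_of_subset_s10 (measurableSet_le measurable_const (hm i)) (hA i)
        (fun ω (hω : x / n + ε ≤ x / n + (X ω - x) * g i ω) => ?_) (hA0 i)
      by_contra hωA
      have hpos : 0 < (X ω - x) * g i ω := by linarith
      have hlt : x < X ω := by
        by_contra! hge
        exact hpos.not_ge (mul_nonpos_of_nonpos_of_nonneg (by linarith) (hg0 i ω))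
      have hmem : ω ∈ ⋃ j, A j := hAx ▸ hlt
      simp [hgA i ω hmem hωA] at hpos
    calc ∑ i, choquetQuantile (v i) (fun ω => x / n + (X ω - x) * g i ω)
        ≤ ∑ _i : Fin n, x / n := Finset.sum_le_sum fun i _ => hle i
      _ = x := by simp [mul_div_cancel₀, hn']

lemma bddBelow_setOf_superlevel_mem (huniv : Set.univ ∉ jointNullSets v) {X : Ω → ℝ}
    (hXb : ∃ M : ℝ, ∀ ω, |X ω| ≤ M) :
    BddBelow {x : ℝ | {ω | x < X ω} ∈ jointNullSets v} := by
  obtain ⟨M, hM⟩ := hXb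
  refine ⟨-M, fun x hx => ?_⟩
  by_contra! hlt
  have heq : {ω | x < X ω} = Set.univ :=
    Set.eq_univ_of_forall fun ω => hlt.trans_le (abs_le.1 (hM ω)).1
  rw [Set.mem_ofPred_eq, heq] at hx
  exact huniv hx

/-- Every allocation has total risk at least the quantile of the joint null sets. -/
lemma sInf_superlevel_le_sum_choquetQuantile (hn : 0 < n)
    (hv : ∀ i, IsBinaryCapacity (v i)) (huniv : Set.univ ∉ jointNullSets v)
    {X : Ω → ℝ} (hX : Measurable X) (hXb : ∃ M : ℝ, ∀ ω, |X ω| ≤ M) {Xs : Fin n → Ω → ℝ}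
    (hm : ∀ i, Measurable (Xs i)) (hb : ∀ i, ∃ M : ℝ, ∀ ω, |Xs i ω| ≤ M)
    (hsum : ∀ ω, ∑ i, Xs i ω = X ω) :
    sInf {x : ℝ | {ω | x < X ω} ∈ jointNullSets v} ≤
      ∑ i, choquetQuantile (v i) (Xs i) := by
  refine le_of_forall_pos_le_add fun ε hε => ?_
  have hn' : (0 : ℝ) < n := by exact_mod_cast hn
  choose t ht hlt using fun i => (hv i).exists_null_lt (hb i) (div_pos hε hn')
  have hmem : {ω | ∑ i, t i < X ω} ∈ jointNullSets v := by
    refine mem_jointNullSets_of_subset hv (measurableSet_lt measurable_const hX) ?_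
      ⟨fun i => {ω | t i ≤ Xs i ω}, fun i => measurableSet_le measurable_const (hm i), ht, rfl⟩
    intro ω (hω : ∑ i, t i < X ω)
    rw [← hsum] at hω
    obtain ⟨i, -, hi⟩ := Finset.exists_lt_of_sum_lt hω
    exact Set.mem_iUnion.2 ⟨i, hi.le⟩
  calc sInf {x : ℝ | {ω | x < X ω} ∈ jointNullSets v}
      ≤ ∑ i, t i := csInf_le (bddBelow_setOf_superlevel_mem huniv hXb) hmem
    _ ≤ ∑ i, (choquetQuantile (v i) (Xs i) + ε / n) := Finset.sum_le_sum fun i _ => (hlt i).le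
    _ = ∑ i, choquetQuantile (v i) (Xs i) + ε := by
      simp [Finset.sum_add_distrib, mul_div_cancel₀, hn'.ne']

end JointNullSets

/-- Inf-convolution of Choquet quantiles.  Let `v 0, …, v (n-1)` be binary capacities and
`C = {A ∈ F : A = ⋃ i, A i, A i ∈ F, v i (A i) = 0}`.  (1) If `Ω ∉ C`, then
`v A = if A ∈ C then 0 else 1` is a binary capacity with null set `C`, and for every
bounded measurable `X` the inf-convolution of `I_{v 0}, …, I_{v (n-1)}` at `X` equals
`inf {x | {X > x} ∈ C}`.  (2) If `Ω ∈ C`, the inf-convolution is `-∞`: for every bounded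
measurable `X` and every `c` there is an allocation of `X` with total risk at most `c`. -/
theorem infConvolution_choquetQuantiles {Ω : Type*} [MeasurableSpace Ω]
    (n : ℕ) (hn : 0 < n)
    (v : Fin n → Set Ω → ℝ) (hv : ∀ i, IsBinaryCapacity (v i))
    (C : Set (Set Ω))
    (hC : C = {A : Set Ω | ∃ As : Fin n → Set Ω,
      (∀ i, MeasurableSet (As i)) ∧ (∀ i, v i (As i) = 0) ∧ A = ⋃ i, As i}) :
    ((Set.univ : Set Ω) ∉ C →
      (IsBinaryCapacity (fun A : Set Ω => if A ∈ C then (0 : ℝ) else 1) ∧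
       {A : Set Ω | MeasurableSet A ∧ (if A ∈ C then (0 : ℝ) else 1) = 0} = C ∧
       ∀ X : Ω → ℝ, Measurable X → (∃ M : ℝ, ∀ ω, |X ω| ≤ M) →
         sInf {y : ℝ | ∃ Xs : Fin n → Ω → ℝ,
             (∀ i, Measurable (Xs i)) ∧ (∀ i, ∃ M : ℝ, ∀ ω, |Xs i ω| ≤ M) ∧
             (∀ ω, ∑ i, Xs i ω = X ω) ∧
             y = ∑ i, choquetQuantile (v i) (Xs i)}
           = sInf {x : ℝ | {ω | x < X ω} ∈ C})) ∧
    ((Set.univ : Set Ω) ∈ C →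
      ∀ X : Ω → ℝ, Measurable X → (∃ M : ℝ, ∀ ω, |X ω| ≤ M) → ∀ c : ℝ,
        ∃ Xs : Fin n → Ω → ℝ,
          (∀ i, Measurable (Xs i)) ∧ (∀ i, ∃ M : ℝ, ∀ ω, |Xs i ω| ≤ M) ∧
          (∀ ω, ∑ i, Xs i ω = X ω) ∧
          ∑ i, choquetQuantile (v i) (Xs i) ≤ c) := by
  change C = jointNullSets v at hC
  subst hC
  refine ⟨fun huniv => ⟨isBinaryCapacity_jointNullSets hv huniv, ?_, fun X hX hXb => ?_⟩,
    fun huniv X hX hXb c => ?_⟩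
  · ext A
    by_cases hA : A ∈ jointNullSets v
    · simp [hA, measurableSet_of_mem_jointNullSets hA]
    · simp [hA]
  · have hlower : ∀ y ∈ {y : ℝ | ∃ Xs : Fin n → Ω → ℝ,
        (∀ i, Measurable (Xs i)) ∧ (∀ i, ∃ M : ℝ, ∀ ω, |Xs i ω| ≤ M) ∧
        (∀ ω, ∑ i, Xs i ω = X ω) ∧ y = ∑ i, choquetQuantile (v i) (Xs i)},
        sInf {x : ℝ | {ω | x < X ω} ∈ jointNullSets v} ≤ y := by
      rintro y ⟨Xs, hm, hb, hsum, rfl⟩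
      exact sInf_superlevel_le_sum_choquetQuantile hn hv huniv hX hXb hm hb hsum
    have hne : {x : ℝ | {ω | x < X ω} ∈ jointNullSets v}.Nonempty := by
      obtain ⟨M, hM⟩ := hXb
      have hempty : {ω | M < X ω} = ∅ :=
        Set.eq_empty_of_forall_notMem fun ω hω => not_lt_of_ge (abs_le.1 (hM ω)).2 hω
      exact ⟨M, by rw [Set.mem_ofPred_eq, hempty]; exact empty_mem_jointNullSets hv⟩
    apply le_antisymm
    · refine le_csInf hne fun x hx => ?_
      obtain ⟨Xs, hm, hb, hsum, hle⟩ :=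
        exists_allocation_sum_choquetQuantile_le hn hv hX hXb hx
      exact (csInf_le ⟨_, hlower⟩ ⟨Xs, hm, hb, hsum, rfl⟩).trans hle
    · obtain ⟨x, hx⟩ := hne
      obtain ⟨Xs, hm, hb, hsum, -⟩ :=
        exists_allocation_sum_choquetQuantile_le hn hv hX hXb hx
      exact le_csInf ⟨_, Xs, hm, hb, hsum, rfl⟩ hlower
  · exact exists_allocation_sum_choquetQuantile_le hn hv hX hXb
      (mem_jointNullSets_of_subset hv (measurableSet_lt measurable_const hX)
        (Set.subset_univ _) huniv)
end

section
/- Let (Ω, F) be a measurable space, let P_1, …, P_n be nonempty sets of probability measures on (Ω, F), and let α_1, …, α_n ∈ (0,1). For each i define the worst-case Value-at-Risk ρ_i(Y) = sup_{Q ∈ P_i} inf{x ∈ ℝ : Q({Y ≥ x}) ≤ α_i} for bounded F-measurable Y. Define C = {A ∈ F : A = ⋃_{i=1}^n A_i for some A_i ∈ F with sup_{Q ∈ P_i} Q(A_i) ≤ α_i for each i}, and assume Ω ∉ C. Then for every bounded F-measurable X : Ω → ℝ, the inf-convolution of ρ_1, …, ρ_n at X satisfies inf{∑_{i=1}^n ρ_i(X_i)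 : (X_1,…,X_n) is an allocation of X} = inf{x ∈ ℝ : {ω : X(ω) > x} ∈ C}. -/
open MeasureTheory Set

/-- The Value-at-Risk of `Y` at level `a` under `Q`. -/
noncomputable def valueAtRisk {Ω : Type*} [MeasurableSpace Ω] (Q : Measure Ω) (a : ℝ)
    (Y : Ω → ℝ) : ℝ :=
  sInf {x : ℝ | (Q {ω | x ≤ Y ω}).toReal ≤ a}

/-- The worst-case Value-at-Risk of `Y` at level `a` over the set of measures `P`. -/
noncomputable def worstCaseVaR {Ω : Type*} [MeasurableSpace Ω] (P : Set (Measure Ω)) (a : ℝ)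
    (Y : Ω → ℝ) : ℝ :=
  sSup {z : ℝ | ∃ Q ∈ P, z = valueAtRisk Q a Y}

section VaR

variable {Ω : Type*} [MeasurableSpace Ω] {P : Set (Measure Ω)} {Q : Measure Ω} {a c M : ℝ}
  {Y : Ω → ℝ}

lemma bddBelow_tail_le [IsProbabilityMeasure Q] (ha : a < 1) (hY : ∀ ω, |Y ω| ≤ M) :
    BddBelow {x : ℝ | (Q {ω | x ≤ Y ω}).toReal ≤ a} := by
  refine ⟨-M, fun x hx => ?_⟩
  by_contra! h
  have huniv : {ω | x ≤ Y ω} = univ :=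
    eq_univ_of_forall fun ω => h.le.trans (abs_le.mp (hY ω)).1
  rw [mem_ofPred_eq, huniv, measure_univ, ENNReal.toReal_one] at hx
  linarith

lemma valueAtRisk_le_of_forall_gt [IsProbabilityMeasure Q] (ha : a < 1) (hY : ∀ ω, |Y ω| ≤ M)
    (h : ∀ t > c, (Q {ω | t ≤ Y ω}).toReal ≤ a) : valueAtRisk Q a Y ≤ c :=
  le_of_forall_gt_imp_ge_of_dense fun t ht => csInf_le (bddBelow_tail_le ha hY) (h t ht)

lemma toReal_tail_le_of_gt (hY : ∀ ω, |Y ω| ≤ M) (ha : 0 ≤ a) {t : ℝ} (ht : M < t) :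
    (Q {ω | t ≤ Y ω}).toReal ≤ a := by
  have hempty : {ω | t ≤ Y ω} = ∅ := eq_empty_of_forall_notMem fun ω hω =>
    absurd (ht.trans_le hω) (not_lt.mpr (abs_le.mp (hY ω)).2)
  simpa [hempty] using ha

lemma worstCaseVaR_le_of_forall_gt (hP : P.Nonempty) (hprob : ∀ Q ∈ P, IsProbabilityMeasure Q)
    (ha : a < 1) (hY : ∀ ω, |Y ω| ≤ M)
    (h : ∀ Q ∈ P, ∀ t > c, (Q {ω | t ≤ Y ω}).toReal ≤ a) : worstCaseVaR P a Y ≤ c := by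
  obtain ⟨Q₀, hQ₀⟩ := hP
  refine csSup_le ⟨_, Q₀, hQ₀, rfl⟩ ?_
  rintro _ ⟨Q, hQ, rfl⟩
  have := hprob Q hQ
  exact valueAtRisk_le_of_forall_gt ha hY (h Q hQ)

lemma toReal_tail_le_of_worstCaseVaR_lt (hprob : ∀ Q ∈ P, IsProbabilityMeasure Q)
    (ha : a ∈ Ioo (0 : ℝ) 1) (hY : ∀ ω, |Y ω| ≤ M) (hQ : Q ∈ P) (hc : worstCaseVaR P a Y < c) :
    (Q {ω | c ≤ Y ω}).toReal ≤ a := by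
  have hbdd : BddAbove {z : ℝ | ∃ Q ∈ P, z = valueAtRisk Q a Y} := by
    refine ⟨M, ?_⟩
    rintro _ ⟨R, hR, rfl⟩
    have := hprob R hR
    exact valueAtRisk_le_of_forall_gt ha.2 hY fun t ht => toReal_tail_le_of_gt hY ha.1.le ht
  have hlt : valueAtRisk Q a Y < c := (le_csSup hbdd ⟨Q, hQ, rfl⟩).trans_lt hc
  obtain ⟨x, hx, hxc⟩ := exists_lt_of_csInf_lt
    ⟨M + 1, toReal_tail_le_of_gt hY ha.1.le (lt_add_one M)⟩ hlt
  have := hprob Q hQ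
  exact (measureReal_mono fun ω (hω : c ≤ Y ω) => hxc.le.trans hω).trans hx

end VaR

/-- A function splits into `n` measurable bounded parts, the `i`-th of which is at most `x / n`
off `A i`, as soon as the sets `A i` have union `{X > x}`. -/
lemma exists_allocation_le_off {Ω : Type*} [MeasurableSpace Ω] {n : ℕ} (hn : 0 < n)
    {X : Ω → ℝ} (hX : Measurable X) {M : ℝ} (hM : ∀ ω, |X ω| ≤ M) {x : ℝ}
    {A : Fin n → Set Ω} (hA : ∀ i, MeasurableSet (A i)) (hXA : {ω | x < X ω} = ⋃ i, A i) :
    ∃ Xs : Fin n → Ω → ℝ, (∀ i, Measurable (Xs i)) ∧ (∀ i, ∃ M : ℝ, ∀ ω, |Xs i ω| ≤ M) ∧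
      (∀ ω, ∑ i, Xs i ω = X ω) ∧ ∀ i, ∀ ω ∉ A i, Xs i ω ≤ x / n := by
  have hn' : (0 : ℝ) < n := by exact_mod_cast hn
  let B : Fin n → Set Ω := disjointed A
  have hB : ∀ i, MeasurableSet (B i) := fun i =>
    disjointedRec (p := MeasurableSet) (fun _ _ ht => ht.diff (hA _)) (hA i)
  have hBU : ⋃ i, B i = {ω | x < X ω} := by rw [hXA]; exact iUnion_disjointed
  have hU : MeasurableSet {ω | X ω ≤ x} := hX measurableSet_Iic
  let Xs : Fin n → Ω → ℝ := fun i ω =>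
    x / n + (B i).indicator (fun ω => X ω - x) ω
      + {ω | X ω ≤ x}.indicator (fun ω => (X ω - x) / n) ω
  refine ⟨Xs, fun i => ?_, fun i => ⟨|x / n| + (M + |x|) + (M + |x|) / n, fun ω => ?_⟩,
    fun ω => ?_, fun i ω hω => ?_⟩
  · exact (measurable_const.add ((hX.sub_const x).indicator (hB i))).add
      (((hX.sub_const x).div_const n).indicator hU)
  · have h : |X ω - x| ≤ M + |x| := (abs_sub _ _).trans (by gcongr; exact hM ω)
    refine (abs_add_three _ _ _).trans (add_le_add (add_le_add le_rfl ?_) ?_)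
    · exact (norm_indicator_le_norm_self (s := B i) (fun ω => X ω - x) ω).trans h
    · refine (norm_indicator_le_norm_self (fun ω => (X ω - x) / n) ω).trans ?_
      rw [Real.norm_eq_abs, abs_div, Nat.abs_cast]
      gcongr
  · simp only [Xs, Finset.sum_add_distrib, Finset.sum_const, Finset.card_univ, Fintype.card_fin,
      nsmul_eq_mul]
    by_cases hω : X ω ≤ x
    · have hnot : ∀ i, ω ∉ B i := fun i hi =>
        not_lt.mpr hω (by exact hBU.subset (mem_iUnion_of_mem i hi))
      rw [indicator_of_mem (by exact hω)]
      simp only [indicator_of_notMem (hnot _), Finset.sum_const_zero]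
      field_simp
      ring
    · obtain ⟨i, hi⟩ := mem_iUnion.mp (hBU.symm.subset (by exact not_le.mp hω))
      rw [indicator_of_notMem (by exact hω), Finset.sum_eq_single i, indicator_of_mem hi]
      · field_simp
        ring
      · intro j _ hj
        exact indicator_of_notMem
          (fun hj' => disjoint_left.mp (disjoint_disjointed A hj) hj' hi) _
      · simp
  · have hω' : ω ∉ B i := fun h => hω (disjointed_subset A i h)
    have : {ω | X ω ≤ x}.indicator (fun ω => (X ω - x) / n) ω ≤ 0 :=
      indicator_nonpos (fun ω (hω : X ω ≤ x) =>
        div_nonpos_of_nonpos_of_nonneg (sub_nonpos.mpr hω) hn'.le) ω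
    simp only [Xs, indicator_of_notMem hω']
    linarith

/-- Inf-convolution of worst-case Value-at-Risk functionals under ambiguity.  Each agent
`i` uses `ρ_i(Y) = sup_{Q ∈ P_i} inf {x | Q {Y ≥ x} ≤ α_i}`.  With
`C = {A : A = ⋃ i A_i, A_i ∈ F, sup_{Q ∈ P_i} Q(A_i) ≤ α_i}` and `Ω ∉ C`, the
inf-convolution of `ρ_1, …, ρ_n` at a bounded measurable `X` equals
`inf {x | {X > x} ∈ C}`. -/
theorem infConvolution_worstCase_VaR {Ω : Type*} [MeasurableSpace Ω]
    (n : ℕ) (hn : 0 < n)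
    (P : Fin n → Set (Measure Ω)) (hP : ∀ i, (P i).Nonempty)
    (hprob : ∀ i, ∀ Q ∈ P i, IsProbabilityMeasure Q)
    (α : Fin n → ℝ) (hα : ∀ i, α i ∈ Set.Ioo (0 : ℝ) 1)
    (C : Set (Set Ω))
    (hC : C = {A : Set Ω | ∃ As : Fin n → Set Ω,
      (∀ i, MeasurableSet (As i)) ∧
      (∀ i, ∀ Q ∈ P i, (Q (As i)).toReal ≤ α i) ∧
      A = ⋃ i, As i})
    (huniv : (Set.univ : Set Ω) ∉ C)
    (X : Ω → ℝ) (hX : Measurable X) (hXb : ∃ M : ℝ, ∀ ω, |X ω| ≤ M) :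
    sInf {y : ℝ | ∃ Xs : Fin n → Ω → ℝ,
        (∀ i, Measurable (Xs i)) ∧ (∀ i, ∃ M : ℝ, ∀ ω, |Xs i ω| ≤ M) ∧
        (∀ ω, ∑ i, Xs i ω = X ω) ∧
        y = ∑ i, sSup {z : ℝ | ∃ Q ∈ P i,
          z = sInf {x : ℝ | (Q {ω | x ≤ Xs i ω}).toReal ≤ α i}}}
      = sInf {x : ℝ | {ω | x < X ω} ∈ C} := by
  obtain ⟨M, hM⟩ := hXb
  have hmem : ∀ A, A ∈ C ↔ ∃ As : Fin n → Set Ω, (∀ i, MeasurableSet (As i)) ∧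
      (∀ i, ∀ Q ∈ P i, (Q (As i)).toReal ≤ α i) ∧ A = ⋃ i, As i := fun A => by rw [hC]; rfl
  have hn' : (0 : ℝ) < n := by exact_mod_cast hn
  set L := {y : ℝ | ∃ Xs : Fin n → Ω → ℝ,
        (∀ i, Measurable (Xs i)) ∧ (∀ i, ∃ M : ℝ, ∀ ω, |Xs i ω| ≤ M) ∧
        (∀ ω, ∑ i, Xs i ω = X ω) ∧ y = ∑ i, worstCaseVaR (P i) (α i) (Xs i)}
  set R := {x : ℝ | {ω | x < X ω} ∈ C}
  change sInf L = sInf R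
  have hRbdd : BddBelow R := by
    refine ⟨-M, fun x hx => ?_⟩
    by_contra! h
    refine huniv ?_
    rwa [← eq_univ_of_forall (s := {ω | x < X ω})
      fun ω => h.trans_le (abs_le.mp (hM ω)).1]
  have hRne : R.Nonempty := by
    refine ⟨M, (hmem _).mpr ⟨fun _ => ∅, fun _ => .empty, fun i Q _ => ?_, ?_⟩⟩
    · simpa using (hα i).1.le
    · simpa [eq_empty_iff_forall_notMem] using fun ω => (abs_le.mp (hM ω)).2
  have hlower : ∀ y ∈ L, sInf R ≤ y := by
    rintro _ ⟨Xs, hXs, hXsb, hsum, rfl⟩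
    refine le_of_forall_pos_le_add fun ε hε => csInf_le hRbdd ((hmem _).mpr ?_)
    set r := fun i => worstCaseVaR (P i) (α i) (Xs i)
    set S := {ω | (∑ i, r i) + ε < X ω}
    refine ⟨fun i => S ∩ {ω | r i + ε / n ≤ Xs i ω}, fun i => ?_, fun i Q hQ => ?_, ?_⟩
    · exact (hX measurableSet_Ioi).inter (hXs i measurableSet_Ici)
    · obtain ⟨K, hK⟩ := hXsb i
      have := hprob i Q hQ
      exact (measureReal_mono inter_subset_right).trans
        (toReal_tail_le_of_worstCaseVaR_lt (hprob i) (hα i) hK hQ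
          (lt_add_of_pos_right _ (div_pos hε hn')))
    · rw [← inter_iUnion, eq_comm, inter_eq_left]
      intro ω hω
      by_contra hnot
      simp only [mem_iUnion, mem_ofPred_eq, not_exists, not_le] at hnot
      have hle : ∑ i, Xs i ω ≤ ∑ i, (r i + ε / n) :=
        Finset.sum_le_sum fun i _ => (hnot i).le
      rw [hsum, Finset.sum_add_distrib, Finset.sum_const, Finset.card_univ, Fintype.card_fin,
        nsmul_eq_mul, mul_div_cancel₀ _ hn'.ne'] at hle
      exact not_lt.mpr hle hω
  have hupper : ∀ x ∈ R, ∃ y ∈ L, y ≤ x := by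
    intro x hx
    obtain ⟨A, hA, hAα, hXA⟩ := (hmem _).mp hx
    obtain ⟨Xs, hXs, hXsb, hsum, hle⟩ := exists_allocation_le_off hn hX hM hA hXA
    refine ⟨_, ⟨Xs, hXs, hXsb, hsum, rfl⟩, ?_⟩
    calc ∑ i, worstCaseVaR (P i) (α i) (Xs i) ≤ ∑ _i : Fin n, x / n := by
          refine Finset.sum_le_sum fun i _ => ?_
          obtain ⟨K, hK⟩ := hXsb i
          refine worstCaseVaR_le_of_forall_gt (hP i) (hprob i) (hα i).2 hK fun Q hQ t ht => ?_
          have := hprob i Q hQ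
          refine (measureReal_mono fun ω (hω : t ≤ Xs i ω) => ?_).trans (hAα i Q hQ)
          by_contra hnot
          exact not_lt.mpr (hle i ω hnot) (ht.trans_le hω)
      _ = x := by simp [mul_div_cancel₀ _ hn'.ne']
  refine le_antisymm (le_csInf hRne fun x hx => ?_) ?_
  · obtain ⟨y, hy, hyx⟩ := hupper x hx
    exact (csInf_le ⟨_, hlower⟩ hy).trans hyx
  · obtain ⟨x, hx⟩ := hRne
    obtain ⟨y, hy, -⟩ := hupper x hx
    exact le_csInf ⟨y, hy⟩ hlower
end

section
/- Let (Ω, F) be a measurable space and Q a probability measure on (Ω, F) that is atomless in the sense that for every A ∈ F and every b ∈ [0, Q(A)] there exists B ∈ F with B ⊆ A and Q(B) = b. Let g_1, …, g_n : [0,1] → [0,1] be strictly increasing continuous functions with g_i(0) = 0 and g_i(1) = 1, let α_1, …, α_n ∈ (0,1), and assume ∑_{i=1}^n g_i^{-1}(α_i) < 1. Then for every bounded F-measurable X : Ω → ℝ, inf{∑_{i=1}^n VaR^{g_i∘Q}_{α_i}(X_i) : (X_1,…,X_n) is an allocation of X} = VaR^Q_{∑_{i=1}^n g_i^{-1}(α_i)}(X),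 where VaR^{g_i∘Q}_{α_i}(Y) = inf{x ∈ ℝ : g_i(Q({Y ≥ x})) ≤ α_i} and VaR^Q_t(X) = inf{x ∈ ℝ : Q({X ≥ x}) ≤ t}. -/
open MeasureTheory Set

/-- Under an atomless measure, a measurable set whose mass is at most `∑ i ∈ s, b i` can be
partitioned into pieces of mass at most `b i`; the partition is encoded by a labelling `f`. -/
theorem exists_measurable_labelling {Ω ι : Type*} [MeasurableSpace Ω]
    [MeasurableSpace ι] {Q : Measure Ω} [IsFiniteMeasure Q]
    (hQ : ∀ A : Set Ω, MeasurableSet A → ∀ b : ENNReal, b ≤ Q A →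
      ∃ B : Set Ω, MeasurableSet B ∧ B ⊆ A ∧ Q B = b)
    {s : Finset ι} (hs : s.Nonempty) (b : ι → ENNReal) {A : Set Ω} (hA : MeasurableSet A)
    (hAb : Q A ≤ ∑ i ∈ s, b i) :
    ∃ f : Ω → ι, Measurable f ∧ (∀ ω, f ω ∈ s) ∧ ∀ i ∈ s, Q (A ∩ f ⁻¹' {i}) ≤ b i := by
  classical
  induction hs using Finset.Nonempty.cons_induction generalizing A with
  | singleton a =>
    refine ⟨fun _ => a, measurable_const, by simp, fun i hi => ?_⟩
    obtain rfl := Finset.mem_singleton.1 hi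
    exact (measure_mono inter_subset_left).trans (by simpa using hAb)
  | cons a s ha _ ih =>
    obtain ⟨B, hB, hBA, hQB⟩ := hQ A hA (min (b a) (Q A)) (min_le_right _ _)
    have hdiff : Q (A \ B) ≤ ∑ i ∈ s, b i := by
      rw [measure_sdiff hBA hB.nullMeasurableSet (measure_ne_top Q B), hQB]
      rw [Finset.sum_cons] at hAb
      rcases le_total (b a) (Q A) with h | h
      · rw [min_eq_left h]
        exact tsub_le_iff_left.2 hAb
      · simp [min_eq_right h]
    obtain ⟨f, hf, hfs, hfb⟩ := ih (hA.diff hB) hdiff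
    refine ⟨B.piecewise (fun _ => a) f, measurable_const.piecewise hB hf, fun ω => ?_,
      fun i hi => ?_⟩
    · by_cases h : ω ∈ B <;> simp [h, hfs]
    · rcases Finset.mem_cons.1 hi with rfl | hi
      · refine (measure_mono ?_).trans (hQB.le.trans (min_le_left _ _))
        rintro ω ⟨-, hω⟩
        by_contra h
        simp only [mem_preimage, Set.piecewise, h, if_false, mem_singleton_iff] at hω
        exact ha (hω ▸ hfs ω)
      · refine (measure_mono ?_).trans (hfb i hi)
        rintro ω ⟨hωA, hω⟩
        by_cases h : ω ∈ B
        · simp only [mem_preimage, Set.piecewise, h, if_true, mem_singleton_iff] at hω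
          exact absurd (hω ▸ hi) ha
        · simp only [mem_preimage, Set.piecewise, h, if_false] at hω
          exact ⟨⟨hωA, h⟩, hω⟩

section ValueAtRisk

variable {Ω : Type*} [MeasurableSpace Ω] {Q : Measure Ω}
  {Y : Ω → ℝ} {t : ℝ}

theorem nonempty_setOf_measure_superlevel_le (hY : ∃ M : ℝ, ∀ ω, |Y ω| ≤ M) (ht : 0 ≤ t) :
    {x : ℝ | (Q {ω | x ≤ Y ω}).toReal ≤ t}.Nonempty := by
  obtain ⟨M, hM⟩ := hY
  refine ⟨M + 1, ?_⟩
  have : {ω | M + 1 ≤ Y ω} = ∅ :=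
    eq_empty_of_forall_notMem fun ω h => by
      have := le_of_abs_le (hM ω)
      simp only [mem_ofPred_eq] at h
      linarith
  simpa [this] using ht

variable [IsProbabilityMeasure Q]

theorem bddBelow_setOf_measure_superlevel_le (hY : ∃ M : ℝ, ∀ ω, |Y ω| ≤ M) (ht : t < 1) :
    BddBelow {x : ℝ | (Q {ω | x ≤ Y ω}).toReal ≤ t} := by
  obtain ⟨M, hM⟩ := hY
  refine ⟨-M, fun x hx => ?_⟩
  by_contra! h
  have : {ω | x ≤ Y ω} = univ := eq_univ_of_forall fun ω => h.le.trans (neg_le_of_abs_le (hM ω))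
  simp only [mem_ofPred_eq, this, measure_univ, ENNReal.toReal_one] at hx
  linarith

theorem measure_superlevel_le_of_sInf_lt (hY : ∃ M : ℝ, ∀ ω, |Y ω| ≤ M) (ht : 0 ≤ t) {z : ℝ}
    (hz : sInf {x : ℝ | (Q {ω | x ≤ Y ω}).toReal ≤ t} < z) :
    (Q {ω | z ≤ Y ω}).toReal ≤ t := by
  obtain ⟨x, hx, hxz⟩ := exists_lt_of_csInf_lt (nonempty_setOf_measure_superlevel_le hY ht) hz
  refine le_trans (ENNReal.toReal_mono (measure_ne_top _ _) (measure_mono ?_)) hx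
  exact fun ω hω => hxz.le.trans hω

/-- Subadditivity of Value-at-Risk when levels are added. -/
theorem sInf_measure_superlevel_sum_le {ι : Type*} [Fintype ι] {Xs : ι → Ω → ℝ} {X : Ω → ℝ}
    {β : ι → ℝ} (hXs : ∀ i, ∃ M : ℝ, ∀ ω, |Xs i ω| ≤ M) (hX : ∃ M : ℝ, ∀ ω, |X ω| ≤ M)
    (hadd : ∀ ω, ∑ i, Xs i ω = X ω) (hβ : ∀ i, 0 ≤ β i) (hsum : ∑ i, β i < 1) :
    sInf {x : ℝ | (Q {ω | x ≤ X ω}).toReal ≤ ∑ i, β i} ≤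
      ∑ i, sInf {x : ℝ | (Q {ω | x ≤ Xs i ω}).toReal ≤ β i} := by
  set v : ι → ℝ := fun i => sInf {x : ℝ | (Q {ω | x ≤ Xs i ω}).toReal ≤ β i}
  have key : ∀ ε > 0, sInf {x : ℝ | (Q {ω | x ≤ X ω}).toReal ≤ ∑ i, β i} ≤
      ∑ i, (v i + ε) + ε := by
    intro ε hε
    refine csInf_le (bddBelow_setOf_measure_superlevel_le hX hsum) ?_
    have hsub : {ω | ∑ i, (v i + ε) + ε ≤ X ω} ⊆ ⋃ i, {ω | v i + ε ≤ Xs i ω} := by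
      intro ω hω
      by_contra h
      simp only [mem_iUnion, mem_ofPred_eq, not_exists, not_le] at h hω
      have := Finset.sum_le_sum fun i (_ : i ∈ Finset.univ) => (h i).le
      rw [hadd] at this
      linarith
    calc Q.real {ω | ∑ i, (v i + ε) + ε ≤ X ω}
        ≤ Q.real (⋃ i, {ω | v i + ε ≤ Xs i ω}) := measureReal_mono hsub
      _ ≤ ∑ i, Q.real {ω | v i + ε ≤ Xs i ω} := measureReal_iUnion_fintype_le _
      _ ≤ ∑ i, β i := Finset.sum_le_sum fun i _ =>
          measure_superlevel_le_of_sInf_lt (hXs i) (hβ i) (lt_add_of_pos_right _ hε)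
  refine le_of_forall_pos_le_add fun ε hε => ?_
  have hc : (0 : ℝ) < Fintype.card ι + 1 := by positivity
  have := key (ε / (Fintype.card ι + 1)) (by positivity)
  rw [Finset.sum_add_distrib, Finset.sum_const, Finset.card_univ, nsmul_eq_mul] at this
  have h2 : (Fintype.card ι : ℝ) * (ε / (Fintype.card ι + 1)) + ε / (Fintype.card ι + 1) = ε := by
    field_simp
  linarith

/-- Under an atomless measure, a risk `X` with `Q (x ≤ X) ≤ ∑ i, β i` has an allocation whose
total Value-at-Risk at the levels `β i` is at most `x`. -/
theorem exists_allocation_sum_sInf_le {ι : Type*} [Fintype ι] [Nonempty ι]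
    (hQ : ∀ A : Set Ω, MeasurableSet A → ∀ b : ENNReal, b ≤ Q A →
      ∃ B : Set Ω, MeasurableSet B ∧ B ⊆ A ∧ Q B = b)
    {X : Ω → ℝ} (hX : Measurable X) (hXb : ∃ M : ℝ, ∀ ω, |X ω| ≤ M) {β : ι → ℝ}
    (hβ : ∀ i, 0 ≤ β i) (hβ' : ∀ i, β i < 1) {x : ℝ}
    (hx : (Q {ω | x ≤ X ω}).toReal ≤ ∑ i, β i) :
    ∃ Xs : ι → Ω → ℝ, (∀ i, Measurable (Xs i)) ∧ (∀ i, ∃ M : ℝ, ∀ ω, |Xs i ω| ≤ M) ∧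
      (∀ ω, ∑ i, Xs i ω = X ω) ∧
      ∑ i, sInf {z : ℝ | (Q {ω | z ≤ Xs i ω}).toReal ≤ β i} ≤ x := by
  classical
  let _ : MeasurableSpace ι := ⊤
  have hA : MeasurableSet {ω | x ≤ X ω} := measurableSet_le measurable_const hX
  have hAb : Q {ω | x ≤ X ω} ≤ ∑ i, ENNReal.ofReal (β i) := by
    rw [← ENNReal.ofReal_sum_of_nonneg fun i _ => hβ i]
    exact (ENNReal.le_ofReal_iff_toReal_le (measure_ne_top _ _)
      (Finset.sum_nonneg fun i _ => hβ i)).2 hx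
  obtain ⟨f, hf, -, hfb⟩ := exists_measurable_labelling hQ Finset.univ_nonempty _ hA hAb
  have hc : (Fintype.card ι : ℝ) ≠ 0 := by simp
  have hbdd : ∀ i, ∃ M : ℝ, ∀ ω,
      |x / Fintype.card ι + if f ω = i then X ω - x else 0| ≤ M := by
    intro i
    obtain ⟨M, hM⟩ := hXb
    refine ⟨|x / Fintype.card ι| + (M + |x|), fun ω => (abs_add_le _ _).trans ?_⟩
    gcongr
    split_ifs
    · exact (abs_sub _ _).trans (by gcongr; exact hM ω)
    · rw [abs_zero]
      exact add_nonneg ((abs_nonneg _).trans (hM ω)) (abs_nonneg _)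
  refine ⟨fun i ω => x / Fintype.card ι + if f ω = i then X ω - x else 0, fun i => ?_, hbdd,
    fun ω => ?_, ?_⟩
  · exact measurable_const.add <| Measurable.ite (hf (t := {i}) trivial)
      (hX.sub_const x) measurable_const
  · rw [Finset.sum_add_distrib, Finset.sum_ite_eq]
    simp
    field_simp
    ring
  · have hle : ∀ i ∈ Finset.univ, sInf {z : ℝ |
        (Q {ω | z ≤ x / Fintype.card ι + if f ω = i then X ω - x else 0}).toReal ≤ β i}
          ≤ x / Fintype.card ι := by
      intro i hi
      refine le_of_forall_pos_le_add fun ε hε => ?_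
      refine csInf_le (bddBelow_setOf_measure_superlevel_le (hbdd i) (hβ' i)) ?_
      refine ENNReal.toReal_le_of_le_ofReal (hβ i) ((measure_mono ?_).trans (hfb i hi))
      intro ω hω
      simp only [mem_ofPred_eq, mem_inter_iff, mem_preimage, mem_singleton_iff] at hω ⊢
      split_ifs at hω with h
      · exact ⟨by linarith, h⟩
      · linarith
    refine (Finset.sum_le_sum hle).trans_eq ?_
    rw [Finset.sum_const, Finset.card_univ, nsmul_eq_mul]
    field_simp

end ValueAtRisk

/-- Inf-convolution of Value-at-Risk functionals under distorted probabilities.  For an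
atomless probability measure `Q`, strictly increasing continuous distortions
`g_i : [0,1] → [0,1]` with `g_i 0 = 0`, `g_i 1 = 1`, levels `α_i ∈ (0,1)` with
`β_i = g_i⁻¹(α_i)` and `∑ β_i < 1`, the inf-convolution of `VaR^{g_i ∘ Q}_{α_i}` at a
bounded measurable `X` equals `VaR^Q_{∑ β_i}(X)`. -/
theorem infConvolution_distorted_VaR {Ω : Type*} [MeasurableSpace Ω]
    (n : ℕ) (hn : 0 < n)
    (Q : Measure Ω) [IsProbabilityMeasure Q]
    (hatomless : ∀ A : Set Ω, MeasurableSet A → ∀ b : ENNReal, b ≤ Q A →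
      ∃ B : Set Ω, MeasurableSet B ∧ B ⊆ A ∧ Q B = b)
    (g : Fin n → ℝ → ℝ)
    (hgmono : ∀ i, StrictMonoOn (g i) (Set.Icc (0 : ℝ) 1))
    (hgcont : ∀ i, ContinuousOn (g i) (Set.Icc (0 : ℝ) 1))
    (hgmaps : ∀ i, Set.MapsTo (g i) (Set.Icc (0 : ℝ) 1) (Set.Icc (0 : ℝ) 1))
    (hg0 : ∀ i, g i 0 = 0) (hg1 : ∀ i, g i 1 = 1)
    (α β : Fin n → ℝ)
    (hα : ∀ i, α i ∈ Set.Ioo (0 : ℝ) 1)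
    (hβ : ∀ i, β i ∈ Set.Icc (0 : ℝ) 1 ∧ g i (β i) = α i)
    (hsum : ∑ i, β i < 1)
    (X : Ω → ℝ) (hX : Measurable X) (hXb : ∃ M : ℝ, ∀ ω, |X ω| ≤ M) :
    sInf {y : ℝ | ∃ Xs : Fin n → Ω → ℝ,
        (∀ i, Measurable (Xs i)) ∧ (∀ i, ∃ M : ℝ, ∀ ω, |Xs i ω| ≤ M) ∧
        (∀ ω, ∑ i, Xs i ω = X ω) ∧
        y = ∑ i, sInf {x : ℝ | g i ((Q {ω | x ≤ Xs i ω}).toReal) ≤ α i}}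
      = sInf {x : ℝ | (Q {ω | x ≤ X ω}).toReal ≤ ∑ i, β i} := by
  have : Nonempty (Fin n) := ⟨⟨0, hn⟩⟩
  have hβ0 : ∀ i, 0 ≤ β i := fun i => (hβ i).1.1
  have hβ1 : ∀ i, β i < 1 := fun i =>
    (Finset.single_le_sum (fun j _ => hβ0 j) (Finset.mem_univ i)).trans_lt hsum
  have hdist : ∀ i (A : Set Ω), g i (Q A).toReal ≤ α i ↔ (Q A).toReal ≤ β i := by
    intro i A
    rw [← (hβ i).2]
    exact (hgmono i).le_iff_le ⟨ENNReal.toReal_nonneg, measureReal_le_one⟩ (hβ i).1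
  simp only [hdist]
  set S : Set ℝ := {y : ℝ | ∃ Xs : Fin n → Ω → ℝ,
        (∀ i, Measurable (Xs i)) ∧ (∀ i, ∃ M : ℝ, ∀ ω, |Xs i ω| ≤ M) ∧
        (∀ ω, ∑ i, Xs i ω = X ω) ∧
        y = ∑ i, sInf {x : ℝ | (Q {ω | x ≤ Xs i ω}).toReal ≤ β i}}
  have hlower : ∀ y ∈ S, sInf {x : ℝ | (Q {ω | x ≤ X ω}).toReal ≤ ∑ i, β i} ≤ y := by
    rintro y ⟨Xs, -, hXsb, hadd, rfl⟩
    exact sInf_measure_superlevel_sum_le hXsb hXb hadd hβ0 hsum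
  have hupper : ∀ x ∈ {x : ℝ | (Q {ω | x ≤ X ω}).toReal ≤ ∑ i, β i}, ∃ y ∈ S, y ≤ x := by
    intro x hx
    obtain ⟨Xs, hm, hb, hadd, hle⟩ :=
      exists_allocation_sum_sInf_le hatomless hX hXb hβ0 hβ1 hx
    exact ⟨_, ⟨Xs, hm, hb, hadd, rfl⟩, hle⟩
  have hne := nonempty_setOf_measure_superlevel_le (Q := Q) hXb
    (Finset.sum_nonneg fun i (_ : i ∈ Finset.univ) => hβ0 i)
  apply le_antisymm
  · refine le_csInf hne fun x hx => ?_
    obtain ⟨y, hy, hyx⟩ := hupper x hx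
    exact (csInf_le ⟨_, hlower⟩ hy).trans hyx
  · obtain ⟨x, hx⟩ := hne
    obtain ⟨y, hy, -⟩ := hupper x hx
    exact le_csInf ⟨y, hy⟩ hlower
end

section
/- Let (Ω, F) be a measurable space, w a capacity on (Ω, F), and α ∈ (0,1]. Define w_α(A) = min(w(A)/α, 1) for A ∈ F. Then w_α is a capacity, and for every bounded F-measurable X : Ω → ℝ the Choquet Expected Shortfall equals the Choquet integral with respect to w_α: ES^w_α(X) = (1/α) ∫_0^α VaR^w_t(X) dt = ∫ X dw_α. -/
open MeasureTheory Set

/-- The Value-at-Risk of level `t` under a capacity `w`: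
`VaR^w_t (X) = inf {x | w {X ≥ x} ≤ t}`. -/
noncomputable def VaRc {Ω : Type*} [MeasurableSpace Ω]
    (w : Set Ω → ℝ) (t : ℝ) (X : Ω → ℝ) : ℝ :=
  sInf {x : ℝ | w {ω | x ≤ X ω} ≤ t}

/-- The capacity obtained by rescaling `w` by `1 / α` and truncating at `1`. -/
theorem IsCapacity.min_div {Ω : Type*} [MeasurableSpace Ω] {w : Set Ω → ℝ} (hw : IsCapacity w)
    {α : ℝ} (hα : α ∈ Set.Ioc (0 : ℝ) 1) : IsCapacity (fun A : Set Ω => min (w A / α) 1) := by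
  obtain ⟨h0, h1, hmono⟩ := hw
  refine ⟨by simp [h0], ?_, fun A B hA hB hAB => ?_⟩
  · simpa [h1] using (one_le_inv₀ hα.1).2 hα.2
  · exact min_le_min_right _ (div_le_div_of_nonneg_right (hmono hA hB hAB) hα.1.le)

section Survival

variable {Ω : Type*} [MeasurableSpace Ω] {w : Set Ω → ℝ} {X : Ω → ℝ} {M x : ℝ}

theorem IsCapacity.antitone_survival (hw : IsCapacity w) (hX : Measurable X) :
    Antitone fun x => w {ω | x ≤ X ω} := fun _ _ hab =>
  hw.2.2 (measurableSet_le measurable_const hX) (measurableSet_le measurable_const hX)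
    fun _ hω => hab.trans hω

theorem IsCapacity.survival_eq_one (hw : IsCapacity w) (hM : ∀ ω, |X ω| ≤ M) (hx : x ≤ -M) :
    w {ω | x ≤ X ω} = 1 := by
  rw [← hw.2.1]
  congr 1
  exact Set.eq_univ_of_forall fun ω => hx.trans (abs_le.1 (hM ω)).1

theorem IsCapacity.survival_eq_zero (hw : IsCapacity w) (hM : ∀ ω, |X ω| ≤ M) (hx : M < x) :
    w {ω | x ≤ X ω} = 0 := by
  rw [← hw.1]
  congr 1
  exact Set.eq_empty_of_forall_notMem fun ω hω =>
    absurd (le_trans hω (abs_le.1 (hM ω)).2) hx.not_ge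

theorem IsCapacity.survival_nonneg (hw : IsCapacity w) (hX : Measurable X) :
    0 ≤ w {ω | x ≤ X ω} := by
  rw [← hw.1]
  exact hw.2.2 .empty (measurableSet_le measurable_const hX) (Set.empty_subset _)

theorem choquetIntegral_eq_intervalIntegral (hw : IsCapacity w) (hX : Measurable X)
    (hM : ∀ ω, |X ω| ≤ M) (hM0 : 0 ≤ M) :
    choquetIntegral w X = -M + ∫ x in (-M)..M, w {ω | x ≤ X ω} := by
  have hint (a b : ℝ) : IntervalIntegrable (fun x => w {ω | x ≤ X ω}) volume a b :=
    (hw.antitone_survival hX).intervalIntegrable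
  have hneg : ∫ x in Set.Iio (0 : ℝ), (w {ω | x ≤ X ω} - 1) =
      ∫ x in (-M)..0, (w {ω | x ≤ X ω} - 1) := by
    rw [← integral_Iic_eq_integral_Iio, intervalIntegral.integral_of_le (by linarith)]
    refine setIntegral_eq_of_subset_of_forall_sdiff_eq_zero measurableSet_Iic
      (fun x hx => hx.2) fun x hx => ?_
    have : x ≤ -M := not_lt.1 fun h => hx.2 ⟨h, hx.1⟩
    rw [hw.survival_eq_one hM this, sub_self]
  have hpos : ∫ x in Set.Ioi (0 : ℝ), w {ω | x ≤ X ω} = ∫ x in (0)..M, w {ω | x ≤ X ω} := by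
    rw [intervalIntegral.integral_of_le hM0]
    refine setIntegral_eq_of_subset_of_forall_sdiff_eq_zero measurableSet_Ioi
      (fun x hx => hx.1) fun x hx => ?_
    have : M < x := not_le.1 fun h => hx.2 ⟨hx.1, h⟩
    exact hw.survival_eq_zero hM this
  rw [choquetIntegral, hneg, hpos, intervalIntegral.integral_sub (hint _ _) (by simp),
    ← intervalIntegral.integral_add_adjacent_intervals (hint (-M) 0) (hint 0 M)]
  simp
  ring

/-- The Value-at-Risk as the length of a superlevel set of the survival function. -/
theorem volume_real_lt_survival (hw : IsCapacity w) (hX : Measurable X) (hM : ∀ ω, |X ω| ≤ M)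
    {t : ℝ} (ht : t ∈ Set.Ioo (0 : ℝ) 1) :
    volume.real ({x | t < w {ω | x ≤ X ω}} ∩ Set.Ioc (-M) M) = VaRc w t X + M := by
  have hlow : ∀ x ∈ {x : ℝ | w {ω | x ≤ X ω} ≤ t}, -M ≤ x := fun x hx => by
    by_contra! h
    have hx : w {ω | x ≤ X ω} ≤ t := hx
    rw [hw.survival_eq_one hM h.le] at hx
    exact hx.not_gt ht.2
  have hmem : ∀ x, M < x → x ∈ {x : ℝ | w {ω | x ≤ X ω} ≤ t} := fun x hx => by
    rw [Set.mem_ofPred_eq, hw.survival_eq_zero hM hx]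
    exact ht.1.le
  have hne : {x : ℝ | w {ω | x ≤ X ω} ≤ t}.Nonempty := ⟨M + 1, hmem _ (by linarith)⟩
  have hbdd : BddBelow {x : ℝ | w {ω | x ≤ X ω} ≤ t} := ⟨-M, hlow⟩
  have hge : -M ≤ VaRc w t X := le_csInf hne hlow
  have hle : VaRc w t X ≤ M := le_of_forall_gt_imp_ge_of_dense fun x hx => csInf_le hbdd (hmem x hx)
  have hsub₁ : Set.Ioo (-M) (VaRc w t X) ⊆ {x | t < w {ω | x ≤ X ω}} ∩ Set.Ioc (-M) M :=
    fun x hx => ⟨lt_of_not_ge fun h : w {ω | x ≤ X ω} ≤ t => hx.2.not_ge (csInf_le hbdd h), hx.1,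
      hx.2.le.trans hle⟩
  have hsub₂ : {x | t < w {ω | x ≤ X ω}} ∩ Set.Ioc (-M) M ⊆ Set.Ioc (-M) (VaRc w t X) :=
    fun x hx => ⟨hx.2.1, le_csInf hne fun y hy => le_of_not_gt fun hyx =>
      hx.1.not_ge ((hw.antitone_survival hX hyx.le).trans hy)⟩
  apply le_antisymm
  · refine (measureReal_mono hsub₂ measure_Ioc_lt_top.ne).trans_eq ?_
    rw [Real.volume_real_Ioc_of_le hge, sub_neg_eq_add]
  · refine Eq.trans_le ?_ (measureReal_mono hsub₁
      (measure_ne_top_of_subset hsub₂ measure_Ioc_lt_top.ne))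
    rw [Real.volume_real_Ioo_of_le hge, sub_neg_eq_add]

theorem intervalIntegral_VaRc (hw : IsCapacity w) (hX : Measurable X) (hM : ∀ ω, |X ω| ≤ M)
    (hM0 : 0 ≤ M) {α : ℝ} (hα : α ∈ Set.Ioc (0 : ℝ) 1) :
    ∫ t in (0 : ℝ)..α, VaRc w t X =
      -(α * M) + ∫ x in (-M)..M, min (w {ω | x ≤ X ω}) α := by
  set G : ℝ → ℝ := fun x => w {ω | x ≤ X ω}
  have hGm : Measurable G := (hw.antitone_survival hX).measurable
  let f : ℝ → ℝ → ℝ := fun t x => {p : ℝ × ℝ | p.1 < G p.2}.indicator 1 (t, x)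
  have hS : MeasurableSet {p : ℝ × ℝ | p.1 < G p.2} :=
    measurableSet_lt measurable_fst (hGm.comp measurable_snd)
  have hf : Integrable (Function.uncurry f)
      ((volume.restrict (Set.Ioo 0 α)).prod (volume.restrict (Set.Ioc (-M) M))) :=
    (integrable_const (1 : ℝ)).indicator hS
  have hinner₁ : ∀ t ∈ Set.Ioo 0 α, ∫ x in Set.Ioc (-M) M, f t x = VaRc w t X + M := fun t ht => by
    have hm : MeasurableSet {x | t < G x} := measurableSet_lt measurable_const hGm
    rw [← volume_real_lt_survival hw hX hM ⟨ht.1, ht.2.trans_le hα.2⟩,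
      ← measureReal_restrict_apply hm, ← integral_indicator_one hm]
    rfl
  have hinner₂ : ∀ x, ∫ t in Set.Ioo 0 α, f t x = min (G x) α := fun x => by
    have : 0 ≤ min (G x) α := le_min (hw.survival_nonneg hX) hα.1.le
    calc ∫ t in Set.Ioo 0 α, f t x
        = ∫ t in Set.Ioo 0 α, (Set.Iio (G x)).indicator 1 t := rfl
      _ = volume.real (Set.Ioo 0 (min (G x) α)) := by
          rw [integral_indicator_one measurableSet_Iio,
            measureReal_restrict_apply measurableSet_Iio, Set.inter_comm, Set.Ioo_inter_Iio,
            min_comm]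
      _ = min (G x) α := by rw [Real.volume_real_Ioo_of_le this, sub_zero]
  have hVaR : ∫ t in Set.Ioo 0 α, VaRc w t X
      = ∫ t in Set.Ioo 0 α, ((∫ x in Set.Ioc (-M) M, f t x) - M) :=
    setIntegral_congr_fun measurableSet_Ioo fun t ht => by simp [hinner₁ t ht]
  have hfint : Integrable (fun t => ∫ x in Set.Ioc (-M) M, f t x)
      (volume.restrict (Set.Ioo 0 α)) := hf.integral_prod_left
  rw [intervalIntegral.integral_of_le hα.1.le, integral_Ioc_eq_integral_Ioo, hVaR,
    integral_sub hfint (integrable_const M), integral_integral_swap hf,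
    intervalIntegral.integral_of_le (by linarith)]
  simp [hinner₂, hα.1.le]
  ring

end Survival

/-- For a capacity `w` and `α ∈ (0,1]`, the set function `w_α = min (w/α) 1` is a
capacity, and the Choquet Expected Shortfall
`ES^w_α (X) = (1/α) ∫_0^α VaR^w_t (X) dt` equals the Choquet integral of `X` with
respect to `w_α`, for every bounded measurable `X`. -/
theorem choquetES_eq_choquetIntegral {Ω : Type*} [MeasurableSpace Ω]
    (w : Set Ω → ℝ) (hw : IsCapacity w)
    (α : ℝ) (hα : α ∈ Set.Ioc (0 : ℝ) 1)
    (X : Ω → ℝ) (hX : Measurable X) (hXb : ∃ M : ℝ, ∀ ω, |X ω| ≤ M) :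
    IsCapacity (fun A : Set Ω => min (w A / α) 1) ∧
    (1 / α) * ∫ t in (0 : ℝ)..α, VaRc w t X
      = choquetIntegral (fun A : Set Ω => min (w A / α) 1) X := by
  refine ⟨hw.min_div hα, ?_⟩
  obtain ⟨M, hM⟩ := hXb
  have hM' : ∀ ω, |X ω| ≤ |M| := fun ω => (hM ω).trans (le_abs_self M)
  rw [choquetIntegral_eq_intervalIntegral (hw.min_div hα) hX hM' (abs_nonneg M),
    intervalIntegral_VaRc hw hX hM' (abs_nonneg M) hα, mul_add,
    ← intervalIntegral.integral_const_mul]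
  have hα0 : α ≠ 0 := hα.1.ne'
  congr 1
  · field_simp
  · refine intervalIntegral.integral_congr fun x _ => ?_
    rw [mul_min_of_nonneg _ _ (one_div_nonneg.2 hα.1.le), one_div_mul_cancel hα0,
      one_div_mul_eq_div]
end
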